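/- arXiv:1712.04068 — 9 statements merged into one kernel-verified Lean document; each statement's English description precedes it below -/
import Mathlib

section
/- For all β, m ∈ ℂ, the function 𝒥_{β,m} is twice differentiable on (0,∞) and satisfies the trigonometric-type Whittaker equation there: for every x > 0, −𝒥_{β,m}''(x) + (m² − 1/4)·x^{−2}·𝒥_{β,m}(x) − (β/x)·𝒥_{β,m}(x) − (1/4)·𝒥_{β,m}(x) = 0. -/
/-- Pochhammer symbol `(a)_k = a (a+1) ⋯ (a+k-1)`. -/
noncomputable def poch (a : ℂ) (k : ℕ) : ℂ := ∏ i ∈ Finset.range k, (a + i)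

/-- Regularized confluent hypergeometric function
`₁𝐅₁(a;c;z) = Σ_{k=0}^∞ (a)_k z^k / (Γ(c+k)·k!)`. -/
noncomputable def regF1 (a c z : ℂ) : ℂ :=
  ∑' k : ℕ, poch a k * z ^ k / (Complex.Gamma (c + k) * (Nat.factorial k))

/-- The function `𝒥_{β,m}(x) = x^{1/2+m} e^{-ix/2} ₁𝐅₁(1/2+m+iβ; 1+2m; ix)` for `x > 0`. -/
noncomputable def WJ (β m : ℂ) (x : ℝ) : ℂ :=
  (x : ℂ) ^ ((1 : ℂ) / 2 + m) * Complex.exp (-(Complex.I * x) / 2) *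
    regF1 (1 / 2 + m + Complex.I * β) (1 + 2 * m) (Complex.I * x)

open Filter Topology

/-- Termwise differentiation preserves absolute convergence on the whole plane. -/
theorem summable_norm_succ_mul_pow {d : ℕ → ℂ} (hd : ∀ z : ℂ, Summable fun k => ‖d k * z ^ k‖)
    (z : ℂ) : Summable fun k : ℕ => ‖((k + 1 : ℕ) * d (k + 1)) * z ^ k‖ := by
  set R : ℝ := max ‖z‖ 1
  have hR : 1 ≤ R := le_max_right _ _
  have hs := (summable_nat_add_iff 1).2 (hd ((2 * R : ℝ) : ℂ))
  refine hs.of_nonneg_of_le (fun _ => norm_nonneg _) fun k => ?_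
  have h2 : ((k + 1 : ℕ) : ℝ) ≤ 2 ^ (k + 1) := by exact_mod_cast (Nat.lt_two_pow_self).le
  have hz : ‖z‖ ^ k ≤ R ^ (k + 1) :=
    (pow_le_pow_left₀ (norm_nonneg _) (le_max_left _ _) k).trans
      (pow_le_pow_right₀ hR (Nat.le_succ k))
  have h2R : (0 : ℝ) ≤ 2 * R := by positivity
  simp only [norm_mul, norm_pow, Complex.norm_natCast, Complex.norm_real,
    Real.norm_of_nonneg h2R]
  rw [mul_pow]
  calc ((k + 1 : ℕ) : ℝ) * ‖d (k + 1)‖ * ‖z‖ ^ k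
      ≤ 2 ^ (k + 1) * ‖d (k + 1)‖ * R ^ (k + 1) := by gcongr
    _ = _ := by ring

/-- A power series `∑ dₖ zᵏ` converging absolutely everywhere has derivative
`∑ (k+1) dₖ₊₁ zᵏ`. -/
theorem hasDerivAt_tsum_mul_pow {d : ℕ → ℂ} (hd : ∀ z : ℂ, Summable fun k => ‖d k * z ^ k‖)
    (z : ℂ) :
    HasDerivAt (fun z => ∑' k, d k * z ^ k) (∑' k : ℕ, ((k + 1 : ℕ) * d (k + 1)) * z ^ k) z := by
  set R : ℝ := ‖z‖ + 1
  have hR : 0 ≤ R := by positivity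
  have hu : Summable fun k : ℕ => ‖d k * (k * (R : ℂ) ^ (k - 1))‖ := by
    rw [← summable_nat_add_iff 1]
    refine (summable_norm_succ_mul_pow hd (R : ℂ)).congr fun k => congrArg norm ?_
    rw [Nat.add_sub_cancel]
    ring
  have hle : ∀ (k : ℕ) (y : ℂ), y ∈ Metric.ball (0 : ℂ) R →
      ‖d k * (k * y ^ (k - 1))‖ ≤ ‖d k * (k * (R : ℂ) ^ (k - 1))‖ := by
    intro k y hy
    have hy' : ‖y‖ ≤ R := (mem_ball_zero_iff.1 hy).le
    simp only [norm_mul, norm_pow, Complex.norm_real, Real.norm_of_nonneg hR]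
    gcongr
  have hz : z ∈ Metric.ball (0 : ℂ) R := mem_ball_zero_iff.2 (lt_add_one _)
  have h := hasDerivAt_tsum_of_isPreconnected hu Metric.isOpen_ball
    (convex_ball (0 : ℂ) R).isPreconnected
    (fun k y _ => (hasDerivAt_pow k y).const_mul (d k)) hle hz (hd z).of_norm hz
  have hs : Summable fun k : ℕ => d k * (k * z ^ (k - 1)) :=
    .of_norm_bounded hu fun k => hle k z hz
  rw [hs.tsum_eq_zero_add] at h
  simpa [mul_comm, mul_left_comm, mul_assoc] using h

/-- The Taylor coefficients of `regF1 a c` at the origin. -/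
noncomputable def regF1Coeff (a c : ℂ) (k : ℕ) : ℂ :=
  poch a k / (Complex.Gamma (c + k) * (Nat.factorial k))

theorem regF1_eq_tsum (a c : ℂ) : regF1 a c = fun z => ∑' k, regF1Coeff a c k * z ^ k := by
  funext z
  simp only [regF1, regF1Coeff, div_mul_eq_mul_div]

theorem regF1Coeff_succ (a c : ℂ) (k : ℕ) :
    (k + 1) * (c + k) * regF1Coeff a c (k + 1) = (a + k) * regF1Coeff a c k := by
  have hG := Complex.one_div_Gamma_eq_self_mul_one_div_Gamma_add_one (c + k)
  have hk : (k + 1 : ℂ) ≠ 0 := by exact_mod_cast k.succ_ne_zero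
  simp only [regF1Coeff, poch, Finset.prod_range_succ, Nat.factorial_succ, div_eq_mul_inv,
    mul_inv, hG]
  push_cast
  rw [← add_assoc]
  field_simp

theorem summable_norm_regF1Coeff (a c z : ℂ) :
    Summable fun k => ‖regF1Coeff a c k * z ^ k‖ := by
  suffices h : Summable fun k => regF1Coeff a c k * z ^ k from h.norm
  refine summable_of_ratio_norm_eventually_le (r := 1 / 2) (by norm_num) ?_
  filter_upwards [eventually_ge_atTop ⌈2 * ‖c‖ + ‖a‖ + 4 * ‖z‖ + 1⌉₊] with k hk
  have hk' : 2 * ‖c‖ + ‖a‖ + 4 * ‖z‖ + 1 ≤ k := (Nat.le_ceil _).trans (by exact_mod_cast hk)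
  have hc := norm_nonneg c
  have ha := norm_nonneg a
  have hz := norm_nonneg z
  have hca : (k : ℝ) - ‖c‖ ≤ ‖c + k‖ := by
    have := norm_sub_norm_le (k : ℂ) (-c)
    rw [norm_neg, Complex.norm_natCast, sub_neg_eq_add, add_comm (k : ℂ)] at this
    exact this
  have hak : ‖a + k‖ ≤ ‖a‖ + k := by
    simpa using norm_add_le a (k : ℂ)
  have hrec : ((k : ℝ) + 1) * ‖c + k‖ * ‖regF1Coeff a c (k + 1)‖
      = ‖a + k‖ * ‖regF1Coeff a c k‖ := by
    have := congrArg norm (regF1Coeff_succ a c k)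
    have hn : ‖(k : ℂ) + 1‖ = k + 1 := by exact_mod_cast Complex.norm_natCast (k + 1)
    simpa only [norm_mul, hn] using this
  have hpos : 0 < ‖c + k‖ := by linarith
  have hD := norm_nonneg (regF1Coeff a c k)
  have hD' := norm_nonneg (regF1Coeff a c (k + 1))
  have hstep : ((k : ℝ) + 1) * ‖regF1Coeff a c (k + 1)‖ ≤ 2 * ‖regF1Coeff a c k‖ := by
    refine le_of_mul_le_mul_left ?_ hpos
    calc ‖c + k‖ * (((k : ℝ) + 1) * ‖regF1Coeff a c (k + 1)‖)
        = ‖a + k‖ * ‖regF1Coeff a c k‖ := by rw [← hrec]; ring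
      _ ≤ (2 * ‖c + k‖) * ‖regF1Coeff a c k‖ := by gcongr; linarith
      _ = _ := by ring
  have hz4 : ‖regF1Coeff a c (k + 1)‖ * ‖z‖ ≤ 1 / 2 * ‖regF1Coeff a c k‖ := by
    nlinarith [mul_le_mul_of_nonneg_left (by linarith : 4 * ‖z‖ ≤ (k : ℝ) + 1) hD']
  simp only [norm_mul, norm_pow, pow_succ]
  calc ‖regF1Coeff a c (k + 1)‖ * (‖z‖ ^ k * ‖z‖)
      = (‖regF1Coeff a c (k + 1)‖ * ‖z‖) * ‖z‖ ^ k := by ring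
    _ ≤ (1 / 2 * ‖regF1Coeff a c k‖) * ‖z‖ ^ k := by gcongr
    _ = _ := by ring

/-- `regF1 a c` is twice complex differentiable and solves Kummer's equation. -/
theorem regF1_kummer (a c : ℂ) :
    ∃ F₁ F₂ : ℂ → ℂ, (∀ z, HasDerivAt (regF1 a c) (F₁ z) z) ∧ (∀ z, HasDerivAt F₁ (F₂ z) z) ∧
      ∀ z, z * F₂ z + (c - z) * F₁ z - a * regF1 a c z = 0 := by
  have h₀ := summable_norm_regF1Coeff a c
  have h₁ := summable_norm_succ_mul_pow h₀
  have h₂ := summable_norm_succ_mul_pow h₁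
  rw [regF1_eq_tsum]
  refine ⟨_, _, hasDerivAt_tsum_mul_pow h₀, hasDerivAt_tsum_mul_pow h₁, fun z => ?_⟩
  set d := regF1Coeff a c
  have s₀ := (h₀ z).of_norm.hasSum
  have s₁ := (h₁ z).of_norm.hasSum
  have zs₁ : HasSum (fun k : ℕ => (k * d k) * z ^ k)
      (z * ∑' k : ℕ, ((k + 1 : ℕ) * d (k + 1)) * z ^ k) := by
    rw [← hasSum_nat_add_iff' 1]
    simpa [pow_succ, mul_comm, mul_left_comm, mul_assoc] using s₁.mul_left z
  have zs₂ : HasSum (fun k : ℕ => (k * ((k + 1 : ℕ) * d (k + 1))) * z ^ k)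
      (z * ∑' k : ℕ, ((k + 1 : ℕ) * ((k + 1 + 1 : ℕ) * d (k + 1 + 1))) * z ^ k) := by
    rw [← hasSum_nat_add_iff' 1]
    simpa [pow_succ, mul_comm, mul_left_comm, mul_assoc] using (h₂ z).of_norm.hasSum.mul_left z
  have key := ((zs₂.add (s₁.mul_left c)).sub zs₁).sub (s₀.mul_left a)
  have hzero : HasSum (fun _ : ℕ => (0 : ℂ)) 0 := hasSum_zero
  have := key.unique (hzero.congr_fun ?_)
  · linear_combination this
  · intro k
    push_cast
    linear_combination z ^ k * regF1Coeff_succ a c k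

/-- The prefactor `z ^ s * exp (-i z / 2)` has logarithmic derivative `s / z - i / 2`. -/
theorem hasDerivAt_cpow_mul_exp (s : ℂ) {z : ℂ} (hz : z ∈ Complex.slitPlane) :
    HasDerivAt (fun z => z ^ s * Complex.exp (-(Complex.I * z) / 2))
      (z ^ s * Complex.exp (-(Complex.I * z) / 2) * (s / z - Complex.I / 2)) z := by
  have hz0 := Complex.slitPlane_ne_zero hz
  have h1 : HasDerivAt (fun z => z ^ s) (s * z ^ (s - 1) * 1) z :=
    (hasDerivAt_id z).cpow_const hz
  have h2 : HasDerivAt (fun z => Complex.exp (-(Complex.I * z) / 2))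
      (Complex.exp (-(Complex.I * z) / 2) * (-(Complex.I * 1) / 2)) z :=
    (((hasDerivAt_id z).const_mul Complex.I).neg.div_const 2).cexp
  convert! h1.mul h2 using 1
  rw [Complex.cpow_sub _ _ hz0, Complex.cpow_one]
  ring

/-- `𝒥_{β,m}` is twice differentiable on `(0,∞)` and satisfies the trigonometric-type
Whittaker equation `-𝒥'' + (m²-1/4) x⁻² 𝒥 - (β/x) 𝒥 - (1/4) 𝒥 = 0` there. -/
theorem WJ_twice_differentiable_and_whittaker_eq (β m : ℂ) :
    (∀ x : ℝ, 0 < x →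
      DifferentiableAt ℝ (WJ β m) x ∧
      DifferentiableAt ℝ (deriv (WJ β m)) x) ∧
    (∀ x : ℝ, 0 < x →
      -(deriv (deriv (WJ β m)) x)
        + (m ^ 2 - 1 / 4) * ((x : ℂ) ^ 2)⁻¹ * WJ β m x
        - β / (x : ℂ) * WJ β m x
        - 1 / 4 * WJ β m x = 0) := by
  obtain ⟨F₁, F₂, hF, hF₁, hode⟩ := regF1_kummer (1 / 2 + m + Complex.I * β) (1 + 2 * m)
  set F := regF1 (1 / 2 + m + Complex.I * β) (1 + 2 * m)
  set s : ℂ := 1 / 2 + m with hs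
  set P : ℂ → ℂ := fun z => z ^ s * Complex.exp (-(Complex.I * z) / 2)
  have hrot : ∀ (f f' : ℂ → ℂ), (∀ z, HasDerivAt f (f' z) z) → ∀ z,
      HasDerivAt (fun z => f (Complex.I * z)) (f' (Complex.I * z) * Complex.I) z := by
    intro f f' hf z
    have h := (hf (Complex.I * z)).comp z ((hasDerivAt_id z).const_mul Complex.I)
    rw [mul_one] at h
    exact h
  set q : ℂ → ℂ := fun z => s / z - Complex.I / 2 with hq
  have hq' : ∀ z ∈ Complex.slitPlane, HasDerivAt q (-s / z ^ 2) z := by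
    intro z hz
    have hz0 := Complex.slitPlane_ne_zero hz
    have h := ((hasDerivAt_inv hz0).const_mul s).sub_const (Complex.I / 2)
    convert! h using 1
    field_simp
  have hP' : ∀ z ∈ Complex.slitPlane, HasDerivAt P (P z * q z) z :=
    fun z hz => hasDerivAt_cpow_mul_exp s hz
  have hW₁ : ∀ x : ℝ, 0 < x → HasDerivAt (WJ β m)
      (P x * (q x * F (Complex.I * x) + F₁ (Complex.I * x) * Complex.I)) x := by
    intro x hx
    have hx' : (x : ℂ) ∈ Complex.slitPlane := Complex.ofReal_mem_slitPlane.2 hx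
    have h := ((hP' x hx').mul (hrot F F₁ hF x)).comp_ofReal
    rw [mul_assoc, ← mul_add] at h
    exact h
  have hW₂ : ∀ x : ℝ, 0 < x → HasDerivAt (deriv (WJ β m))
      (P x * q x * (q x * F (Complex.I * x) + F₁ (Complex.I * x) * Complex.I)
        + P x * (-s / x ^ 2 * F (Complex.I * x) + q x * (F₁ (Complex.I * x) * Complex.I)
          + F₂ (Complex.I * x) * Complex.I * Complex.I)) x := by
    intro x hx
    have hx' : (x : ℂ) ∈ Complex.slitPlane := Complex.ofReal_mem_slitPlane.2 hx
    have h := ((hP' x hx').mul (((hq' x hx').mul (hrot F F₁ hF x)).add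
      ((hrot F₁ F₂ hF₁ x).mul_const Complex.I))).comp_ofReal
    refine h.congr_of_eventuallyEq ?_
    filter_upwards [eventually_gt_nhds hx] with y hy using (hW₁ y hy).deriv
  refine ⟨fun x hx => ⟨(hW₁ x hx).differentiableAt, (hW₂ x hx).differentiableAt⟩, fun x hx => ?_⟩
  rw [(hW₂ x hx).deriv]
  have hW : WJ β m x = P x * F (Complex.I * x) := rfl
  have hx0 : (x : ℂ) ≠ 0 := by exact_mod_cast hx.ne'
  have hk := hode (Complex.I * x)
  rw [hW]
  simp only [hq]
  generalize F (Complex.I * x) = f at *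
  generalize F₁ (Complex.I * x) = f₁ at *
  generalize F₂ (Complex.I * x) = f₂ at *
  generalize P x = p at *
  have hI := Complex.I_sq
  rw [hs] at hk ⊢
  linear_combination (norm := skip) (-Complex.I * p / x) * hk
    - (p * f / 4 + p * f * β / x) * hI
  field_simp
  ring
end

section
/- Let m ∈ ℂ with 1+2m not a nonpositive integer, and let n ∈ ℕ. Then for every x > 0: ℐ_{1/2+m+n, m}(x) = n!·x^{1/2+m}·e^{−x/2}·L_n^{(2m)}(x)/Γ(1+2m+n), and ℐ_{−(1/2+m+n), m}(x) = n!·x^{1/2+m}·e^{x/2}·L_n^{(2m)}(−x)/Γ(1+2m+n). -/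
/-- The Whittaker-type function `ℐ_{β,m}(z) = z^{1/2+m} e^{-z/2} ₁𝐅₁(1/2+m-β; 1+2m; z)`. -/
noncomputable def WI (β m z : ℂ) : ℂ :=
  z ^ ((1 : ℂ) / 2 + m) * Complex.exp (-z / 2) * regF1 (1 / 2 + m - β) (1 + 2 * m) z

/-- Generalized Laguerre polynomial
`L_n^{(α)}(z) = Σ_{k=0}^n (−1)^k Γ(n+α+1) z^k / (Γ(k+α+1) (n−k)! k!)`. -/
noncomputable def lagC (n : ℕ) (α z : ℂ) : ℂ :=
  ∑ k ∈ Finset.range (n + 1),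
    (-1) ^ k * Complex.Gamma (n + α + 1) * z ^ k /
      (Complex.Gamma (k + α + 1) * (Nat.factorial (n - k)) * (Nat.factorial k))

lemma poch_succ (a : ℂ) (k : ℕ) : poch a (k + 1) = poch a k * (a + k) :=
  Finset.prod_range_succ _ _

lemma poch_succ_left (a : ℂ) (k : ℕ) : poch a (k + 1) = a * poch (a + 1) k := by
  simp only [poch, Finset.prod_range_succ']
  rw [mul_comm]
  push_cast
  congr 1
  · ring
  · exact Finset.prod_congr rfl fun i _ => by ring

lemma poch_add_one_succ (a : ℂ) (k : ℕ) :
    poch (a + 1) (k + 1) = poch a (k + 1) + (k + 1) * poch (a + 1) k := by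
  rw [poch_succ, poch_succ_left]
  ring

lemma poch_neg_natCast (n k : ℕ) : poch (-(n : ℂ)) k = (-1) ^ k * (n.descFactorial k : ℂ) := by
  induction k with
  | zero => simp [poch]
  | succ k ih =>
    rw [poch_succ, ih, Nat.descFactorial_succ]
    rcases le_or_gt k n with h | h
    · push_cast [h]
      ring
    · simp [Nat.descFactorial_of_lt h]

lemma poch_div_Gamma {c : ℂ} (hc : ∀ j : ℕ, c ≠ -(j : ℂ)) (k : ℕ) :
    poch c k / Complex.Gamma (c + k) = 1 / Complex.Gamma c := by
  induction k with
  | zero => simp [poch]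
  | succ k ih =>
    have h : c + k ≠ 0 := fun h => hc k (eq_neg_of_add_eq_zero_left h)
    rw [← ih, poch_succ]
    push_cast
    rw [← add_assoc, Complex.Gamma_add_one _ h, mul_comm, mul_div_mul_left _ _ h]

lemma add_natCast_ne_neg_natCast {c : ℂ} (hc : ∀ j : ℕ, c ≠ -(j : ℂ)) (n : ℕ) :
    ∀ j : ℕ, c + n ≠ -(j : ℂ) := fun j h => hc (j + n) <| by
  push_cast
  linear_combination h

/-- Kummer's transformation of `₁𝐅₁(c + n; c; z)` for `n ∈ ℕ`. -/
lemma hasSum_regF1_add_natCast (n : ℕ) {c : ℂ} (hc : ∀ j : ℕ, c ≠ -(j : ℂ)) (z : ℂ) :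
    HasSum (fun k : ℕ => poch (c + n) k * z ^ k / (Complex.Gamma (c + k) * (Nat.factorial k)))
      (Complex.exp z *
        ∑ j ∈ Finset.range (n + 1), (n.choose j : ℂ) * (z ^ j / Complex.Gamma (c + j))) := by
  induction n generalizing c with
  | zero =>
    have h := (NormedSpace.expSeries_div_hasSum_exp z).mul_right (1 / Complex.Gamma c)
    rw [← Complex.exp_eq_exp_ℂ] at h
    convert! h using 1
    · funext k
      rw [← poch_div_Gamma hc k]
      simp only [Nat.cast_zero, add_zero]
      ring
    · simp
  | succ n ih =>
    have hc1 : ∀ j : ℕ, c + 1 ≠ -(j : ℂ) := by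
      simpa using add_natCast_ne_neg_natCast hc 1
    have h0 := ih hc
    have h1 := (ih hc1).mul_left z
    rw [← hasSum_nat_add_iff' 1] at h0 ⊢
    convert h0.add h1 using 1
    · funext k
      have hk : ((k : ℂ) + 1) ≠ 0 := Nat.cast_add_one_ne_zero k
      have hf : (Nat.factorial k : ℂ) ≠ 0 := Nat.cast_ne_zero.mpr k.factorial_ne_zero
      have hG : Complex.Gamma (c + 1 + k) ≠ 0 :=
        Complex.Gamma_ne_zero (add_natCast_ne_neg_natCast hc1 k)
      have e1 : c + ((n + 1 : ℕ) : ℂ) = c + n + 1 := by push_cast; ring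
      have e2 : c + 1 + (n : ℂ) = c + n + 1 := by ring
      have e3 : c + ((k + 1 : ℕ) : ℂ) = c + 1 + k := by push_cast; ring
      rw [e1, e2, e3, poch_add_one_succ, Nat.factorial_succ]
      push_cast
      field_simp
      ring
    · rw [Finset.sum_choose_succ_mul (fun j _ => z ^ j / Complex.Gamma (c + j)) n]
      have e (j : ℕ) : c + ((j + 1 : ℕ) : ℂ) = c + 1 + j := by push_cast; ring
      simp only [e, pow_succ, Finset.sum_range_one, poch, Finset.prod_range_zero]
      rw [mul_add]
      have : ∑ j ∈ Finset.range (n + 1),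
          (n.choose j : ℂ) * (z ^ j * z / Complex.Gamma (c + 1 + j)) =
          z * ∑ j ∈ Finset.range (n + 1),
            (n.choose j : ℂ) * (z ^ j / Complex.Gamma (c + 1 + j)) := by
        rw [Finset.mul_sum]
        exact Finset.sum_congr rfl fun j _ => by ring
      rw [this]
      ring

lemma regF1_neg_natCast (n : ℕ) (c z : ℂ) :
    regF1 (-(n : ℂ)) c z =
      ∑ j ∈ Finset.range (n + 1), (n.choose j : ℂ) * ((-z) ^ j / Complex.Gamma (c + j)) := by
  rw [regF1, tsum_eq_sum (s := Finset.range (n + 1))]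
  · refine Finset.sum_congr rfl fun j _ => ?_
    have hf : (Nat.factorial j : ℂ) ≠ 0 := Nat.cast_ne_zero.mpr j.factorial_ne_zero
    rw [poch_neg_natCast, Nat.descFactorial_eq_factorial_mul_choose, neg_pow z,
      mul_comm (Complex.Gamma _)]
    push_cast
    rw [show (-1 : ℂ) ^ j * (Nat.factorial j * n.choose j) * z ^ j =
      Nat.factorial j * (n.choose j * ((-1) ^ j * z ^ j)) by ring, mul_div_mul_left _ _ hf,
      mul_div_assoc]
  · intro j hj
    have : n < j := by simpa [Nat.lt_succ_iff] using hj
    simp [poch_neg_natCast, Nat.descFactorial_of_lt this]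

lemma factorial_mul_lagC_div_Gamma (n : ℕ) {α : ℂ} (hα : ∀ j : ℕ, 1 + α ≠ -(j : ℂ)) (z : ℂ) :
    (Nat.factorial n : ℂ) * lagC n α z / Complex.Gamma (1 + α + n) =
      ∑ j ∈ Finset.range (n + 1),
        (n.choose j : ℂ) * ((-z) ^ j / Complex.Gamma (1 + α + j)) := by
  rw [lagC, Finset.mul_sum, Finset.sum_div]
  refine Finset.sum_congr rfl fun j hj => ?_
  have hjn : j ≤ n := Nat.lt_succ_iff.mp (Finset.mem_range.mp hj)
  have hG (k : ℕ) : Complex.Gamma (1 + α + k) ≠ 0 :=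
    Complex.Gamma_ne_zero (add_natCast_ne_neg_natCast hα k)
  have hn := hG n
  have hj' := hG j
  have e (k : ℕ) : (k : ℂ) + α + 1 = 1 + α + k := by ring
  have hf (k : ℕ) : (Nat.factorial k : ℂ) ≠ 0 := Nat.cast_ne_zero.mpr k.factorial_ne_zero
  have h1 := hf j
  have h2 := hf (n - j)
  rw [e, e, Nat.cast_choose ℂ hjn, neg_pow z]
  field_simp

/-- For `1+2m` not a nonpositive integer and `n ∈ ℕ`,
`ℐ_{±(1/2+m+n), m}(x) = n! x^{1/2+m} e^{∓x/2} L_n^{(2m)}(±x) / Γ(1+2m+n)`. -/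
theorem WI_eq_laguerre (m : ℂ) (hm : ∀ j : ℕ, (1 : ℂ) + 2 * m ≠ -(j : ℂ)) (n : ℕ) :
    ∀ x : ℝ, 0 < x →
      WI (1 / 2 + m + n) m (x : ℂ) =
        (Nat.factorial n : ℂ) * (x : ℂ) ^ ((1 : ℂ) / 2 + m) * Complex.exp (-(x : ℂ) / 2) *
          lagC n (2 * m) (x : ℂ) / Complex.Gamma (1 + 2 * m + n) ∧
      WI (-(1 / 2 + m + n)) m (x : ℂ) =
        (Nat.factorial n : ℂ) * (x : ℂ) ^ ((1 : ℂ) / 2 + m) * Complex.exp ((x : ℂ) / 2) *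
          lagC n (2 * m) (-(x : ℂ)) / Complex.Gamma (1 + 2 * m + n) := by
  intro x _
  constructor
  · rw [WI, show (1 : ℂ) / 2 + m - (1 / 2 + m + n) = -(n : ℂ) by ring, regF1_neg_natCast,
      ← factorial_mul_lagC_div_Gamma n hm]
    ring
  · have h := factorial_mul_lagC_div_Gamma n hm (-(x : ℂ))
    rw [neg_neg] at h
    rw [WI, show (1 : ℂ) / 2 + m - -(1 / 2 + m + n) = 1 + 2 * m + n by ring, regF1,
      (hasSum_regF1_add_natCast n hm x).tsum_eq, ← h,
      show Complex.exp ((x : ℂ) / 2) = Complex.exp (-(x : ℂ) / 2) * Complex.exp x by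
        rw [← Complex.exp_add]; ring_nf]
    ring
end

section
/- For every p ∈ ℕ, every β ∈ ℂ, and every x > 0, one has the degenerate-case identity ℐ_{β,−p/2}(x) = (−β − (p−1)/2)_p · ℐ_{β,p/2}(x), where (a)_p denotes the Pochhammer symbol. -/
theorem poch_add (a : ℂ) (m n : ℕ) : poch a (m + n) = poch a m * poch (a + m) n := by
  simp only [poch, Finset.prod_range_add, Nat.cast_add, add_assoc]

/-- At a nonpositive integer `1 - p` the regularized confluent function reduces to the one with
second parameter `1 + p`. -/
theorem regF1_one_sub_natCast (a z : ℂ) (p : ℕ) :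
    regF1 a (1 - p) z = poch a p * z ^ p * regF1 (a + p) (1 + p) z := by
  unfold regF1
  rw [← tsum_mul_left, ← (add_right_injective p).tsum_eq]
  · refine tsum_congr fun j => ?_
    have h₁ : Complex.Gamma (1 - p + ((p + j : ℕ) : ℂ)) = (Nat.factorial j : ℂ) := by
      rw [← Complex.Gamma_nat_eq_factorial]
      congr 1
      push_cast
      ring
    have h₂ : Complex.Gamma (1 + p + (j : ℂ)) = (Nat.factorial (p + j) : ℂ) := by
      rw [← Complex.Gamma_nat_eq_factorial]
      congr 1
      push_cast
      ring
    rw [h₁, h₂, poch_add, pow_add]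
    ring
  · intro k hk
    by_contra h
    have hkp : k < p := by
      by_contra! hpk
      exact h ⟨k - p, by dsimp only; omega⟩
    refine hk ?_
    have hG : Complex.Gamma (1 - p + (k : ℂ)) = 0 := by
      obtain ⟨d, rfl⟩ := Nat.exists_eq_add_of_lt hkp
      rw [← Complex.Gamma_neg_nat_eq_zero d]
      congr 1
      push_cast
      ring
    simp [hG]

/-- Degenerate-case identity:
`ℐ_{β,−p/2}(x) = (−β − (p−1)/2)_p · ℐ_{β,p/2}(x)` for all `p ∈ ℕ`, `β ∈ ℂ`, `x > 0`. -/
theorem WI_degenerate (p : ℕ) (β : ℂ) :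
    ∀ x : ℝ, 0 < x →
      WI β (-(p : ℂ) / 2) (x : ℂ) =
        poch (-β - ((p : ℂ) - 1) / 2) p * WI β ((p : ℂ) / 2) (x : ℂ) := by
  intro x hx
  have hx0 : (x : ℂ) ≠ 0 := by exact_mod_cast hx.ne'
  have hpow : (x : ℂ) ^ ((1 : ℂ) / 2 + (p : ℂ) / 2) =
      (x : ℂ) ^ ((1 : ℂ) / 2 + -(p : ℂ) / 2) * (x : ℂ) ^ p := by
    rw [← Complex.cpow_natCast, ← Complex.cpow_add _ _ hx0]
    congr 1
    ring
  have ha : (1 : ℂ) / 2 + -(p : ℂ) / 2 - β = -β - ((p : ℂ) - 1) / 2 := by ring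
  have ha' : -β - ((p : ℂ) - 1) / 2 + p = 1 / 2 + (p : ℂ) / 2 - β := by ring
  have hc : (1 : ℂ) + 2 * (-(p : ℂ) / 2) = 1 - p := by ring
  have hc' : (1 : ℂ) + 2 * ((p : ℂ) / 2) = 1 + p := by ring
  unfold WI
  rw [ha, hc, hc', regF1_one_sub_natCast, ha', hpow]
  ring
end

section
/- For all m ∈ ℂ and all x > 0, the function ℐ_{0,m} is related to the modified Bessel function: ℐ_{0,m}(x) = (√(πx)/Γ(1/2+m)) · Σ_{k=0}^∞ (x/4)^{m+2k}/(k!·Γ(m+k+1)), i.e., ℐ_{0,m}(x) = (√(πx)/Γ(1/2+m))·I_m(x/2) where I_m is the modified Bessel function defined by its power series. -/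
/-- The modified Bessel function `I_m(w) = Σ_{k=0}^∞ (w/2)^{m+2k} / (k! Γ(m+k+1))`
(principal branch powers). -/
noncomputable def besselI (m w : ℂ) : ℂ :=
  ∑' k : ℕ, (w / 2) ^ (m + 2 * (k : ℂ)) / ((Nat.factorial k : ℂ) * Complex.Gamma (m + k + 1))

open PowerSeries in
/-- The product of the exponential series `exp (-X/2)` with a power series solving Kummer's equation
`X F'' + (2a - X) F' = a F` solves `X f'' + 2a f' = X f / 4`. -/
theorem kummer_ode_mul_exp {a : ℂ} {E F : ℂ⟦X⟧}
    (hE : d⁄dX ℂ E = C (-1 / 2 : ℂ) * E)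
    (hF : X * d⁄dX ℂ (d⁄dX ℂ F) + (C (2 * a) - X) * d⁄dX ℂ F = C a * F) :
    X * d⁄dX ℂ (d⁄dX ℂ (E * F)) + C (2 * a) * d⁄dX ℂ (E * F) = C (1 / 4 : ℂ) * (X * (E * F)) := by
  have h2 : (C (-1 / 2 : ℂ) : ℂ⟦X⟧) * 2 = -1 := by
    rw [show (2 : ℂ⟦X⟧) = C (2 : ℂ) from (map_ofNat C 2).symm, ← map_mul]
    norm_num
  have h4 : (C (1 / 4 : ℂ) : ℂ⟦X⟧) = C (-1 / 2 : ℂ) * C (-1 / 2 : ℂ) := by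
    rw [← map_mul]
    norm_num
  have hC : d⁄dX ℂ (C (-1 / 2 : ℂ) : ℂ⟦X⟧) = 0 := derivative_C
  have ha : (C (2 * a) : ℂ⟦X⟧) = 2 * C a := by rw [map_mul, map_ofNat]
  simp only [Derivation.leibniz, map_add, smul_eq_mul, hE, hC, h4, ha] at hF ⊢
  linear_combination E * hF + E * (X * d⁄dX ℂ F + C a * F) * h2

/-- The coefficients of the power series of `₁𝐅₁(a; c; ·)`. -/
noncomputable def kummerCoeff (a c : ℂ) (k : ℕ) : ℂ :=
  poch a k / (Complex.Gamma (c + k) * (Nat.factorial k))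

theorem kummerCoeff_succ (a c : ℂ) (k : ℕ) :
    (c + k) * (k + 1) * kummerCoeff a c (k + 1) = (a + k) * kummerCoeff a c k := by
  have hΓ := Complex.one_div_Gamma_eq_self_mul_one_div_Gamma_add_one (c + k)
  have hk : (k + 1 : ℂ) ≠ 0 := Nat.cast_add_one_ne_zero k
  have hf : (Nat.factorial k : ℂ) ≠ 0 := mod_cast Nat.factorial_ne_zero k
  have h1 : kummerCoeff a c k = poch a k / (Nat.factorial k) * (Complex.Gamma (c + k))⁻¹ := by
    rw [kummerCoeff, div_eq_mul_inv, mul_inv, div_eq_mul_inv]; ring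
  have h2 : kummerCoeff a c (k + 1) = poch a k * (a + k) / ((k + 1) * Nat.factorial k) *
      (Complex.Gamma (c + k + 1))⁻¹ := by
    rw [kummerCoeff, poch, Finset.prod_range_succ, Nat.factorial_succ, ← poch, div_eq_mul_inv,
      mul_inv, div_eq_mul_inv]
    push_cast
    rw [← add_assoc]
    ring
  rw [h1, h2, hΓ]
  field_simp

open PowerSeries in
theorem kummerCoeff_ode (a c : ℂ) :
    X * d⁄dX ℂ (d⁄dX ℂ (mk (kummerCoeff a c))) + (C c - X) * d⁄dX ℂ (mk (kummerCoeff a c)) =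
      C a * mk (kummerCoeff a c) := by
  ext n
  rw [sub_mul]
  rcases n with _ | n
  · have := kummerCoeff_succ a c 0
    simp only [map_add, map_sub, coeff_zero_X_mul, coeff_derivative, coeff_C_mul, coeff_mk]
    push_cast at this ⊢
    linear_combination this
  · have := kummerCoeff_succ a c (n + 1)
    simp only [map_add, map_sub, coeff_succ_X_mul, coeff_derivative, coeff_C_mul, coeff_mk]
    push_cast at this ⊢
    linear_combination this

open PowerSeries in
/-- The exponential power series `exp (-X/2)`. -/
noncomputable def expNegHalf : ℂ⟦X⟧ := mk fun n => (-1 / 2) ^ n / (Nat.factorial n)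

open PowerSeries in
theorem derivative_expNegHalf : d⁄dX ℂ expNegHalf = C (-1 / 2 : ℂ) * expNegHalf := by
  ext n
  have hk : (n + 1 : ℂ) ≠ 0 := Nat.cast_add_one_ne_zero n
  have hf : (Nat.factorial n : ℂ) ≠ 0 := mod_cast Nat.factorial_ne_zero n
  simp only [expNegHalf, coeff_derivative, coeff_C_mul, coeff_mk, Nat.factorial_succ]
  push_cast
  field_simp
  ring

/-- The coefficients of `e^{-z/2} ₁𝐅₁(1/2 + m; 1 + 2m; z)`. -/
noncomputable def whittakerCoeff (m : ℂ) (n : ℕ) : ℂ :=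
  PowerSeries.coeff n (expNegHalf * PowerSeries.mk (kummerCoeff (1 / 2 + m) (1 + 2 * m)))

open PowerSeries in
theorem whittakerCoeff_ode (m : ℂ) :
    X * d⁄dX ℂ (d⁄dX ℂ (mk (whittakerCoeff m))) + C (1 + 2 * m) * d⁄dX ℂ (mk (whittakerCoeff m)) =
      C (1 / 4 : ℂ) * (X * mk (whittakerCoeff m)) := by
  have hmk : mk (whittakerCoeff m) =
      expNegHalf * mk (kummerCoeff (1 / 2 + m) (1 + 2 * m)) := by
    ext n; simp [whittakerCoeff]
  have hc : 1 + 2 * m = 2 * (1 / 2 + m) := by ring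
  have := kummer_ode_mul_exp (a := 1 / 2 + m) derivative_expNegHalf
    (hc ▸ kummerCoeff_ode (1 / 2 + m) (1 + 2 * m))
  rw [hmk]
  rwa [← hc] at this

theorem whittakerCoeff_zero (m : ℂ) : whittakerCoeff m 0 = (Complex.Gamma (1 + 2 * m))⁻¹ := by
  simp [whittakerCoeff, expNegHalf, kummerCoeff, poch]

theorem whittakerCoeff_one (m : ℂ) : (1 + 2 * m) * whittakerCoeff m 1 = 0 := by
  have h := congrArg (PowerSeries.coeff 0) (whittakerCoeff_ode m)
  rw [map_add] at h
  simp only [PowerSeries.coeff_zero_X_mul, PowerSeries.coeff_derivative,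
    PowerSeries.coeff_C_mul, PowerSeries.coeff_mk] at h
  push_cast at h
  linear_combination h

theorem whittakerCoeff_add_two (m : ℂ) (n : ℕ) :
    (n + 2) * (n + 2 + 2 * m) * whittakerCoeff m (n + 2) = whittakerCoeff m n / 4 := by
  have := congrArg (PowerSeries.coeff (n + 1)) (whittakerCoeff_ode m)
  rw [map_add] at this
  simp only [PowerSeries.coeff_succ_X_mul, PowerSeries.coeff_derivative,
    PowerSeries.coeff_C_mul, PowerSeries.coeff_mk] at this
  push_cast at this
  linear_combination this

theorem continuous_inv_Gamma : Continuous fun s : ℂ => (Complex.Gamma s)⁻¹ :=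
  Complex.differentiable_one_div_Gamma.continuous

theorem continuous_whittakerCoeff (n : ℕ) : Continuous fun m => whittakerCoeff m n := by
  simp only [whittakerCoeff, PowerSeries.coeff_mul, PowerSeries.coeff_mk, kummerCoeff, poch,
    div_eq_mul_inv _ (_ * _), mul_inv]
  refine continuous_finsetSum _ fun p _ => continuous_const.mul (Continuous.mul (by fun_prop) ?_)
  exact (continuous_inv_Gamma.comp (by fun_prop)).mul continuous_const

/-- The even coefficients of `e^{-z/2} ₁𝐅₁(1/2 + m; 1 + 2m; z)` in closed form. -/
noncomputable def besselCoeff (m : ℂ) (k : ℕ) : ℂ :=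
  Real.sqrt Real.pi * 2 ^ (-2 * m) * (Complex.Gamma (1 / 2 + m))⁻¹ *
    ((1 / 16) ^ k * (Nat.factorial k : ℂ)⁻¹ * (Complex.Gamma (m + k + 1))⁻¹)

theorem continuous_besselCoeff (k : ℕ) : Continuous fun m => besselCoeff m k := by
  have h1 : Continuous fun m : ℂ => (Complex.Gamma (1 / 2 + m))⁻¹ :=
    continuous_inv_Gamma.comp (by fun_prop)
  have h2 : Continuous fun m : ℂ => (Complex.Gamma (m + k + 1))⁻¹ :=
    continuous_inv_Gamma.comp (by fun_prop)
  have h3 : Continuous fun m : ℂ => (2 : ℂ) ^ (-2 * m) :=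
    Continuous.const_cpow (by fun_prop) (Or.inl two_ne_zero)
  unfold besselCoeff
  fun_prop

theorem besselCoeff_zero {m : ℂ} : besselCoeff m 0 = (Complex.Gamma (1 + 2 * m))⁻¹ := by
  have h := Complex.Gamma_mul_Gamma_add_half (m + 1 / 2)
  rw [show m + 1 / 2 + 1 / 2 = m + 1 by ring, show 2 * (m + 1 / 2) = 1 + 2 * m by ring,
    show 1 - (1 + 2 * m) = -2 * m by ring, add_comm m (1 / 2)] at h
  have hπ : (Real.sqrt Real.pi : ℂ) ≠ 0 := mod_cast (Real.sqrt_pos.2 Real.pi_pos).ne'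
  have h2 : (2 : ℂ) ^ (-2 * m) ≠ 0 := by simp [Complex.cpow_eq_zero_iff]
  have h' := congrArg (·⁻¹) h
  simp only [mul_inv] at h'
  simp only [besselCoeff, pow_zero, Nat.factorial_zero, Nat.cast_one, inv_one, one_mul,
    Nat.cast_zero, add_zero, mul_assoc]
  rw [h']
  field_simp

theorem besselCoeff_succ (m : ℂ) (k : ℕ) :
    16 * (k + 1) * (m + k + 1) * besselCoeff m (k + 1) = besselCoeff m k := by
  have hΓ := Complex.one_div_Gamma_eq_self_mul_one_div_Gamma_add_one (m + k + 1)
  have hk : (k + 1 : ℂ) ≠ 0 := Nat.cast_add_one_ne_zero k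
  simp only [besselCoeff, Nat.factorial_succ]
  push_cast
  rw [hΓ, ← add_assoc m (k : ℂ) 1, mul_inv]
  field_simp
  ring

theorem dense_forall_natCast_add_two_mul_ne_zero :
    Dense {m : ℂ | ∀ n : ℕ, (n + 2 * m : ℂ) ≠ 0} := by
  have hc : (Set.range fun n : ℕ => (-n / 2 : ℂ)).Countable := Set.countable_range _
  refine (hc.dense_compl ℝ).mono fun m hm n h => ?_
  refine hm ⟨n, ?_⟩
  change (-n / 2 : ℂ) = m
  linear_combination (-1 / 2 : ℂ) * h

theorem whittakerCoeff_even (m : ℂ) (k : ℕ) : whittakerCoeff m (2 * k) = besselCoeff m k := by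
  refine congrFun (Continuous.ext_on dense_forall_natCast_add_two_mul_ne_zero
    (continuous_whittakerCoeff (2 * k)) (continuous_besselCoeff k) fun m hm => ?_) m
  induction k with
  | zero => simp [whittakerCoeff_zero, besselCoeff_zero]
  | succ k ih =>
    have h1 := whittakerCoeff_add_two m (2 * k)
    have h2 := besselCoeff_succ m k
    have h3 := hm (2 * k + 2)
    have hk : (k + 1 : ℂ) ≠ 0 := Nat.cast_add_one_ne_zero k
    push_cast at h1 h3
    have h4 : (4 * (k + 1) * (2 * k + 2 + 2 * m) : ℂ) ≠ 0 := by simp [hk, h3]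
    rw [ih] at h1
    refine mul_left_cancel₀ h4 ?_
    rw [show 2 * (k + 1) = 2 * k + 2 by ring]
    linear_combination 2 * h1 - h2 / 2

theorem whittakerCoeff_odd (m : ℂ) (k : ℕ) : whittakerCoeff m (2 * k + 1) = 0 := by
  refine congrFun (Continuous.ext_on dense_forall_natCast_add_two_mul_ne_zero
    (continuous_whittakerCoeff (2 * k + 1)) continuous_const fun m hm => ?_) m
  induction k with
  | zero => exact (mul_eq_zero.1 (whittakerCoeff_one m)).resolve_left (by simpa using hm 1)
  | succ k ih =>
    have h1 := whittakerCoeff_add_two m (2 * k + 1)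
    have h3 := hm (2 * k + 1 + 2)
    have hk : ((2 * k + 1 : ℕ) + 2 : ℂ) ≠ 0 := by norm_cast
    rw [ih, zero_div] at h1
    refine (mul_eq_zero.1 h1).resolve_left (mul_ne_zero hk ?_)
    exact_mod_cast h3

theorem summable_norm_kummerCoeff (a c z : ℂ) :
    Summable fun k => ‖kummerCoeff a c k * z ^ k‖ := by
  refine summable_norm_iff.2 ?_
  refine summable_of_ratio_norm_eventually_le (r := 1 / 2) one_half_lt_one ?_
  filter_upwards [Filter.eventually_ge_atTop ⌈‖a‖ + 2 * ‖c‖ + 1⌉₊,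
    Filter.eventually_ge_atTop ⌈4 * ‖z‖⌉₊] with k hk hz
  rw [Nat.ceil_le] at hk hz
  have hrec := congrArg norm (kummerCoeff_succ a c k)
  have hk1 : ‖(k + 1 : ℂ)‖ = k + 1 := by
    rw [← Nat.cast_add_one, Complex.norm_natCast, Nat.cast_add_one]
  simp only [norm_mul, norm_pow, hk1] at hrec ⊢
  have ha : ‖a + k‖ ≤ ‖a‖ + k := by simpa using norm_add_le a (k : ℂ)
  have hc : k - ‖c‖ ≤ ‖c + k‖ := by
    have := norm_sub_le (c + k) c
    simp only [add_sub_cancel_left, Complex.norm_natCast] at this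
    linarith
  have hpos : 0 < ‖c + k‖ := by linarith [norm_nonneg a, norm_nonneg c]
  have hac : ‖a + k‖ ≤ 2 * ‖c + k‖ := by linarith
  have key : (k + 1) * ‖kummerCoeff a c (k + 1)‖ ≤ 2 * ‖kummerCoeff a c k‖ := by
    refine le_of_mul_le_mul_left ?_ hpos
    calc _ = ‖a + k‖ * ‖kummerCoeff a c k‖ := by rw [← hrec]; ring
      _ ≤ 2 * ‖c + k‖ * ‖kummerCoeff a c k‖ := by gcongr
      _ = _ := by ring
  have key' : ‖kummerCoeff a c (k + 1)‖ * ‖z‖ ≤ 1 / 2 * ‖kummerCoeff a c k‖ := by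
    have : 4 * ‖z‖ * ‖kummerCoeff a c (k + 1)‖ ≤ (k + 1) * ‖kummerCoeff a c (k + 1)‖ := by
      gcongr
      linarith
    linarith
  calc _ = ‖kummerCoeff a c (k + 1)‖ * ‖z‖ * ‖z‖ ^ k := by ring
    _ ≤ 1 / 2 * ‖kummerCoeff a c k‖ * ‖z‖ ^ k := by gcongr
    _ = _ := by ring

/-- Kummer's second formula for the regularized confluent hypergeometric function. -/
theorem exp_mul_regF1 (m z : ℂ) :
    Complex.exp (-z / 2) * regF1 (1 / 2 + m) (1 + 2 * m) z =
      ∑' k : ℕ, besselCoeff m k * z ^ (2 * k) := by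
  have hF : regF1 (1 / 2 + m) (1 + 2 * m) z =
      ∑' k, kummerCoeff (1 / 2 + m) (1 + 2 * m) k * z ^ k :=
    tsum_congr fun k => by rw [kummerCoeff]; ring
  have hE : Complex.exp (-z / 2) = ∑' n : ℕ, (-z / 2) ^ n / (Nat.factorial n : ℂ) := by
    rw [Complex.exp_eq_exp_ℂ, NormedSpace.exp_eq_tsum_div]
  rw [hE, hF, tsum_mul_tsum_eq_tsum_sum_antidiagonal_of_summable_norm
    (NormedSpace.norm_expSeries_div_summable (-z / 2)) (summable_norm_kummerCoeff _ _ z)]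
  have hterm (n : ℕ) : ∑ p ∈ Finset.HasAntidiagonal.antidiagonal n,
      (-z / 2) ^ p.1 / (Nat.factorial p.1 : ℂ) *
      (kummerCoeff (1 / 2 + m) (1 + 2 * m) p.2 * z ^ p.2) = whittakerCoeff m n * z ^ n := by
    rw [whittakerCoeff, PowerSeries.coeff_mul, Finset.sum_mul]
    refine Finset.sum_congr rfl fun p hp => ?_
    rw [← Finset.HasAntidiagonal.mem_antidiagonal.1 hp, expNegHalf, PowerSeries.coeff_mk,
      PowerSeries.coeff_mk,
      show -z / 2 = -1 / 2 * z by ring, mul_pow, pow_add]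
    ring
  simp only [hterm, ← whittakerCoeff_even]
  refine (Function.Injective.tsum_eq (g := fun k : ℕ => 2 * k)
    (mul_right_injective₀ two_ne_zero) fun n hn => ?_).symm
  obtain ⟨k, rfl | rfl⟩ := n.even_or_odd'
  · exact ⟨k, rfl⟩
  · simp [whittakerCoeff_odd] at hn

theorem ofReal_cpow_half_add {x : ℝ} (hx : 0 < x) (m : ℂ) :
    (Real.sqrt Real.pi : ℂ) * 2 ^ (-2 * m) * (x : ℂ) ^ ((1 : ℂ) / 2 + m) =
      Real.sqrt (Real.pi * x) * ((x : ℂ) / 4) ^ m := by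
  have hx' : (x : ℂ) ≠ 0 := mod_cast hx.ne'
  have h4 : ((x : ℂ) / 4) ^ m = (x : ℂ) ^ m * 2 ^ (-2 * m) := by
    have h16 : ((1 / 4 : ℝ) : ℂ) ^ m = 2 ^ (-2 * m) := by
      rw [show ((1 / 4 : ℝ) : ℂ) = (2 : ℂ) ^ (-2 : ℂ) by
        rw [Complex.cpow_neg]; norm_num]
      have hlog : (Complex.log 2 * (-2)).im = 0 := by
        rw [show (2 : ℂ) = (2 : ℝ) by norm_num, ← Complex.ofReal_log zero_le_two,
          ← Complex.ofReal_neg, ← Complex.ofReal_mul, Complex.ofReal_im]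
      rw [Complex.cpow_mul _ (by rw [hlog]; linarith [Real.pi_pos])
        (by rw [hlog]; exact Real.pi_pos.le)]
    rw [← h16, ← Complex.mul_cpow_ofReal_nonneg hx.le (by norm_num)]
    push_cast
    congr 1
    ring
  have hs : (x : ℂ) ^ ((1 : ℂ) / 2) = Real.sqrt x := by
    rw [Real.sqrt_eq_rpow, Complex.ofReal_cpow hx.le]; simp
  rw [h4, Complex.cpow_add _ _ hx', hs, Real.sqrt_mul Real.pi_pos.le, Complex.ofReal_mul]
  ring

/-- `ℐ_{0,m}(x) = (√(πx)/Γ(1/2+m)) · I_m(x/2)` for all `x > 0`. -/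
theorem WI_zero_eq_besselI (m : ℂ) :
    ∀ x : ℝ, 0 < x →
      WI 0 m (x : ℂ) =
        (Real.sqrt (Real.pi * x) : ℂ) / Complex.Gamma (1 / 2 + m) * besselI m ((x : ℂ) / 2) := by
  intro x hx
  have hx4 : (x : ℂ) / 4 ≠ 0 := div_ne_zero (mod_cast hx.ne') (by norm_num)
  rw [WI, sub_zero, mul_assoc, exp_mul_regF1, besselI, ← tsum_mul_left, ← tsum_mul_left]
  refine tsum_congr fun k => ?_
  have hpow : ((x : ℂ) / 4) ^ (2 * (k : ℂ)) = (1 / 16) ^ k * (x : ℂ) ^ (2 * k) := by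
    rw [show (2 * (k : ℂ)) = ((2 * k : ℕ) : ℂ) by push_cast; rfl, Complex.cpow_natCast, pow_mul,
      pow_mul, ← mul_pow]
    ring
  rw [show (x : ℂ) / 2 / 2 = x / 4 by ring, Complex.cpow_add _ _ hx4, hpow, besselCoeff,
    div_eq_mul_inv _ (Complex.Gamma _), div_eq_mul_inv _ (_ * Complex.Gamma _), mul_inv]
  linear_combination (Complex.Gamma (1 / 2 + m))⁻¹ * ((1 / 16) ^ k * (Nat.factorial k : ℂ)⁻¹ *
    (Complex.Gamma (m + k + 1))⁻¹) * (x : ℂ) ^ (2 * k) * ofReal_cpow_half_add hx m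
end

section
/- Let m ∈ ℂ and β ∈ ℂ∖(−∞,0]. Define j_{β,m}(x) := x^{1/4}·𝒥_{2m}(2√(βx)) for x > 0, using the principal square root. Then j_{β,m} is twice differentiable on (0,∞) and satisfies the zero-energy Whittaker equation: for every x > 0, −j_{β,m}''(x) + (m² − 1/4)·x^{−2}·j_{β,m}(x) − (β/x)·j_{β,m}(x) = 0. -/
/-- The Bessel function `J_ν(z) = Σ_{k=0}^∞ (−1)^k (z/2)^{ν+2k} / (k! Γ(ν+k+1))`,
with principal branch powers. -/
noncomputable def besselJ (ν z : ℂ) : ℂ :=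
  ∑' k : ℕ, (-1) ^ k * (z / 2) ^ (ν + 2 * (k : ℂ)) /
    ((Nat.factorial k : ℂ) * Complex.Gamma (ν + k + 1))

/-- The Bessel function for dimension 1: `𝒥_ν(z) = √(πz/2) · J_ν(z)`. -/
noncomputable def calJ (ν z : ℂ) : ℂ :=
  ((Real.pi : ℂ) * z / 2) ^ ((1 : ℂ) / 2) * besselJ ν z

/-- The zero-energy solution `j_{β,m}(x) = x^{1/4} 𝒥_{2m}(2√(βx))`. -/
noncomputable def jfun (β m : ℂ) (x : ℝ) : ℂ :=
  (x : ℂ) ^ ((1 : ℂ) / 4) * calJ (2 * m) (2 * (β * x) ^ ((1 : ℂ) / 2))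

/-- The `k`-th term of the entire series `∑ (-w)^k / (k! Γ(ν+k+1))`. -/
noncomputable def besselTerm (ν w : ℂ) (k : ℕ) : ℂ :=
  (-1) ^ k * w ^ k / ((Nat.factorial k : ℂ) * Complex.Gamma (ν + k + 1))

/-- The entire function `∑ (-w)^k / (k! Γ(ν+k+1))`, so that
`J_ν(z) = (z/2)^ν · besselEntire ν (z²/4)`. -/
noncomputable def besselEntire (ν w : ℂ) : ℂ :=
  ∑' k : ℕ, besselTerm ν w k

theorem besselTerm_succ (ν w : ℂ) (k : ℕ) :
    ((k : ℂ) + 1) * (ν + k + 1) * besselTerm ν w (k + 1) = -w * besselTerm ν w k := by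
  have h := Complex.one_div_Gamma_eq_self_mul_one_div_Gamma_add_one (ν + k + 1)
  have hk : (Nat.factorial k : ℂ) ≠ 0 := Nat.cast_ne_zero.mpr (Nat.factorial_ne_zero k)
  have hk' : (k : ℂ) + 1 ≠ 0 := Nat.cast_add_one_ne_zero k
  have e : ν + ((k : ℂ) + 1) + 1 = ν + k + 1 + 1 := by ring
  simp only [besselTerm, e, div_eq_mul_inv, mul_inv, Nat.factorial_succ, Nat.cast_mul,
    Nat.cast_succ, pow_succ] at h ⊢
  rw [h]
  field_simp

theorem summable_besselTerm (ν w : ℂ) : Summable (besselTerm ν w) := by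
  refine summable_of_ratio_norm_eventually_le (r := 1 / 2) (by norm_num) ?_
  obtain ⟨N, hN⟩ := exists_nat_ge (‖ν‖ + 2 * ‖w‖)
  filter_upwards [Filter.eventually_ge_atTop N] with k hk
  have hkN : (N : ℝ) ≤ k := by exact_mod_cast hk
  have h := congrArg norm (besselTerm_succ ν w k)
  simp only [norm_mul, norm_neg] at h
  have h1 : ‖(k : ℂ) + 1‖ = k + 1 := by
    exact_mod_cast Complex.norm_natCast (k + 1)
  have h2 : (k : ℝ) + 1 - ‖ν‖ ≤ ‖ν + k + 1‖ := by
    have := norm_sub_norm_le ((k : ℂ) + 1) (-ν)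
    rw [h1, norm_neg, sub_neg_eq_add] at this
    rwa [show ν + k + 1 = (k : ℂ) + 1 + ν by ring]
  rw [h1] at h
  have h3 : 2 * ‖w‖ + 1 ≤ ‖ν + k + 1‖ := by linarith
  have h4 : 2 * ‖w‖ + 1 ≤ (k + 1) * ‖ν + k + 1‖ := by
    nlinarith [norm_nonneg w, Nat.cast_nonneg (α := ℝ) k]
  have h5 := mul_le_mul_of_nonneg_right h4 (norm_nonneg (besselTerm ν w (k + 1)))
  have h6 : 0 < 2 * ‖w‖ + 1 := by positivity
  refine le_of_mul_le_mul_left ?_ h6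
  nlinarith [norm_nonneg (besselTerm ν w k)]

theorem hasDerivAt_besselTerm_succ (ν w : ℂ) (k : ℕ) :
    HasDerivAt (fun y => besselTerm ν y (k + 1)) (-besselTerm (ν + 1) w k) w := by
  have h := ((hasDerivAt_pow (k + 1) w).const_mul ((-1 : ℂ) ^ (k + 1))).div_const
    ((Nat.factorial (k + 1) : ℂ) * Complex.Gamma (ν + (k + 1 : ℕ) + 1))
  refine h.congr_deriv ?_
  have hk : (Nat.factorial k : ℂ) ≠ 0 := Nat.cast_ne_zero.mpr (Nat.factorial_ne_zero k)
  have hk' : (k : ℂ) + 1 ≠ 0 := Nat.cast_add_one_ne_zero k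
  have e : ν + ((k : ℂ) + 1) + 1 = ν + 1 + k + 1 := by ring
  simp only [besselTerm, e, div_eq_mul_inv, mul_inv, Nat.factorial_succ, Nat.cast_mul,
    Nat.cast_succ, pow_succ, Nat.add_sub_cancel]
  field_simp

theorem norm_besselTerm_le (ν : ℂ) {w : ℂ} {R : ℝ} (hw : ‖w‖ ≤ R) (k : ℕ) :
    ‖besselTerm ν w k‖ ≤ ‖besselTerm ν R k‖ := by
  have hR : ‖w‖ ≤ ‖(R : ℂ)‖ := by
    rw [Complex.norm_real]; exact hw.trans (le_abs_self R)
  simp only [besselTerm, norm_div, norm_mul, norm_pow]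
  gcongr

theorem hasDerivAt_besselEntire (ν w : ℂ) :
    HasDerivAt (besselEntire ν) (-besselEntire (ν + 1) w) w := by
  have hsplit : besselEntire ν =
      fun y => besselTerm ν 0 0 + ∑' k : ℕ, besselTerm ν y (k + 1) := by
    funext y
    rw [besselEntire, (summable_besselTerm ν y).tsum_eq_zero_add]
    simp [besselTerm]
  rw [hsplit, besselEntire, ← tsum_neg]
  have hw : w ∈ Metric.ball (0 : ℂ) (‖w‖ + 1) := by simp
  refine (hasDerivAt_tsum_of_isPreconnected
    (summable_besselTerm (ν + 1) ((‖w‖ + 1 : ℝ) : ℂ)).norm Metric.isOpen_ball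
    (convex_ball (0 : ℂ) (‖w‖ + 1)).isPreconnected
    (fun k y _ => hasDerivAt_besselTerm_succ ν y k) (fun k y hy => ?_) hw
    ((summable_nat_add_iff 1).mpr (summable_besselTerm ν w)) hw).const_add _
  rw [norm_neg]
  exact norm_besselTerm_le _ (mem_ball_zero_iff.mp hy).le k

theorem besselEntire_recurrence (ν w : ℂ) :
    w * besselEntire (ν + 2) w - (ν + 1) * besselEntire (ν + 1) w + besselEntire ν w = 0 := by
  have e2 : w * besselEntire (ν + 2) w = ∑' k : ℕ, -((k : ℂ) * besselTerm (ν + 1) w k) := by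
    have hterm (k : ℕ) : -(((k + 1 : ℕ) : ℂ) * besselTerm (ν + 1) w (k + 1)) =
        w * besselTerm (ν + 2) w k := by
      have hk : (Nat.factorial k : ℂ) ≠ 0 := Nat.cast_ne_zero.mpr (Nat.factorial_ne_zero k)
      have hk' : (k : ℂ) + 1 ≠ 0 := Nat.cast_add_one_ne_zero k
      have e : ν + 1 + ((k : ℂ) + 1) + 1 = ν + 2 + k + 1 := by ring
      simp only [besselTerm, e, div_eq_mul_inv, mul_inv, Nat.factorial_succ, Nat.cast_mul,
        Nat.cast_succ, pow_succ]
      field_simp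
    have hs : Summable fun k : ℕ => -((k : ℂ) * besselTerm (ν + 1) w k) := by
      rw [← summable_nat_add_iff 1]
      simp only [hterm]
      exact (summable_besselTerm (ν + 2) w).mul_left w
    rw [hs.tsum_eq_zero_add]
    simp only [hterm, tsum_mul_left, besselEntire]
    simp
  have e0 (k : ℕ) : besselTerm ν w k =
      (ν + 1) * besselTerm (ν + 1) w k - -((k : ℂ) * besselTerm (ν + 1) w k) := by
    have h := Complex.one_div_Gamma_eq_self_mul_one_div_Gamma_add_one (ν + k + 1)
    simp only [besselTerm, show ν + 1 + (k : ℂ) + 1 = ν + k + 1 + 1 by ring, div_eq_mul_inv,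
      mul_inv] at h ⊢
    rw [h]
    ring
  have hs1 := (summable_besselTerm (ν + 1) w).mul_left (ν + 1)
  have hs2 : Summable fun k : ℕ => -((k : ℂ) * besselTerm (ν + 1) w k) := by
    refine (hs1.sub (summable_besselTerm ν w)).congr fun k => ?_
    rw [e0]; ring
  have h0 : besselEntire ν w = (ν + 1) * besselEntire (ν + 1) w - w * besselEntire (ν + 2) w := by
    rw [e2, besselEntire, besselEntire, ← tsum_mul_left, ← hs1.tsum_sub hs2]
    exact tsum_congr e0
  rw [h0]; ring

theorem log_cpow_half {w : ℂ} (hw : w ≠ 0) :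
    Complex.log (w ^ ((1 : ℂ) / 2)) = Complex.log w / 2 := by
  rw [Complex.cpow_def_of_ne_zero hw, Complex.log_exp]
  · ring
  all_goals
    have h1 := Complex.neg_pi_lt_arg w
    have h2 := Complex.arg_le_pi w
    have e : (Complex.log w * (1 / 2)).im = Complex.arg w / 2 := by
      rw [show Complex.log w * (1 / 2) = Complex.log w / 2 by ring, ← Complex.log_im]
      exact Complex.div_ofNat_im _ 2
    rw [e]
    linarith [Real.pi_pos]

theorem besselJ_two_mul_cpow_half (ν : ℂ) {w : ℂ} (hw : w ≠ 0) :
    besselJ ν (2 * w ^ ((1 : ℂ) / 2)) = w ^ (ν / 2) * besselEntire ν w := by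
  rw [besselJ, besselEntire, ← tsum_mul_left]
  refine tsum_congr fun k => ?_
  have hs : w ^ ((1 : ℂ) / 2) ≠ 0 := by simp [Complex.cpow_eq_zero_iff, hw]
  have key : (2 * w ^ ((1 : ℂ) / 2) / 2) ^ (ν + 2 * (k : ℂ)) = w ^ (ν / 2) * w ^ k := by
    rw [mul_div_cancel_left₀ _ two_ne_zero, Complex.cpow_def_of_ne_zero hs, log_cpow_half hw,
      ← Complex.cpow_natCast, ← Complex.cpow_add _ _ hw, Complex.cpow_def_of_ne_zero hw]
    ring_nf
  rw [key, besselTerm]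
  ring

theorem ofReal_mul_cpow {x : ℝ} (hx : 0 < x) {w : ℂ} (hw : w ≠ 0) (s : ℂ) :
    ((x : ℂ) * w) ^ s = (x : ℂ) ^ s * w ^ s := by
  have hx' : (x : ℂ) ≠ 0 := by exact_mod_cast hx.ne'
  rw [Complex.cpow_def_of_ne_zero (mul_ne_zero hx' hw), Complex.cpow_def_of_ne_zero hx',
    Complex.cpow_def_of_ne_zero hw, Complex.log_ofReal_mul hx hw, Complex.ofReal_log hx.le,
    ← Complex.exp_add, add_mul]

theorem jfun_eq (m : ℂ) {β : ℂ} (hβ : β ≠ 0) {x : ℝ} (hx : 0 < x) :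
    jfun β m x = (Real.pi : ℂ) ^ ((1 : ℂ) / 2) * β ^ (m + 1 / 4) *
      ((x : ℂ) ^ (m + 1 / 2) * besselEntire (2 * m) (β * x)) := by
  have hx' : (x : ℂ) ≠ 0 := by exact_mod_cast hx.ne'
  have hw : β * x ≠ 0 := mul_ne_zero hβ hx'
  have hs : (β * x) ^ ((1 : ℂ) / 2) ≠ 0 := by simp [Complex.cpow_eq_zero_iff, hβ, hx']
  have hpi : ((Real.pi : ℂ) * (2 * (β * x) ^ ((1 : ℂ) / 2)) / 2) ^ ((1 : ℂ) / 2) =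
      (Real.pi : ℂ) ^ ((1 : ℂ) / 2) * (β * x) ^ ((1 : ℂ) / 4) := by
    rw [show (Real.pi : ℂ) * (2 * (β * x) ^ ((1 : ℂ) / 2)) / 2 =
        Real.pi * (β * x) ^ ((1 : ℂ) / 2) by ring,
      ofReal_mul_cpow Real.pi_pos hs,
      Complex.cpow_def_of_ne_zero hs, log_cpow_half hw, Complex.cpow_def_of_ne_zero hw (1 / 4)]
    ring_nf
  have hmul (s : ℂ) : (β * x) ^ s = β ^ s * (x : ℂ) ^ s := by
    rw [mul_comm, ofReal_mul_cpow hx hβ, mul_comm]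
  have hxp : (x : ℂ) ^ (m + 1 / 2) =
      (x : ℂ) ^ ((1 : ℂ) / 4) * (x : ℂ) ^ ((1 : ℂ) / 4) * (x : ℂ) ^ m := by
    rw [← Complex.cpow_add _ _ hx', ← Complex.cpow_add _ _ hx']
    ring_nf
  rw [jfun, calJ, besselJ_two_mul_cpow_half _ hw, hpi, mul_div_cancel_left₀ _ two_ne_zero,
    hmul, hmul, hxp, Complex.cpow_add _ _ hβ]
  ring

theorem hasDerivAt_cpow_mul_besselEntire (μ ν β : ℂ) {z : ℂ} (hz : z ∈ Complex.slitPlane) :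
    HasDerivAt (fun z => z ^ μ * besselEntire ν (β * z))
      (μ * (z ^ (μ - 1) * besselEntire ν (β * z)) -
        β * (z ^ μ * besselEntire (ν + 1) (β * z))) z := by
  have h1 := (hasDerivAt_id z).cpow_const (c := μ) hz
  have h2 : HasDerivAt (fun z => besselEntire ν (β * z))
      (-besselEntire (ν + 1) (β * z) * (β * 1)) z :=
    (hasDerivAt_besselEntire ν (β * z)).comp z ((hasDerivAt_id z).const_mul β)
  refine (h1.mul h2).congr_deriv ?_
  simp only [id]
  ring

theorem hasDerivAt_jfun (m : ℂ) {β : ℂ} (hβ : β ≠ 0) {x : ℝ} (hx : 0 < x) :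
    HasDerivAt (jfun β m) ((Real.pi : ℂ) ^ ((1 : ℂ) / 2) * β ^ (m + 1 / 4) *
      ((m + 1 / 2) * ((x : ℂ) ^ (m + 1 / 2 - 1) * besselEntire (2 * m) (β * x)) -
        β * ((x : ℂ) ^ (m + 1 / 2) * besselEntire (2 * m + 1) (β * x)))) x := by
  have hz : (x : ℂ) ∈ Complex.slitPlane := Complex.ofReal_mem_slitPlane.mpr hx
  refine ((hasDerivAt_cpow_mul_besselEntire (m + 1 / 2) (2 * m) β hz).const_mul
    _).comp_ofReal.congr_of_eventuallyEq ?_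
  filter_upwards [lt_mem_nhds hx] with y hy using jfun_eq m hβ hy

theorem hasDerivAt_deriv_jfun (m : ℂ) {β : ℂ} (hβ : β ≠ 0) {x : ℝ} (hx : 0 < x) :
    HasDerivAt (deriv (jfun β m))
      ((m ^ 2 - 1 / 4) * ((x : ℂ) ^ 2)⁻¹ * jfun β m x - β / (x : ℂ) * jfun β m x) x := by
  have hz : (x : ℂ) ∈ Complex.slitPlane := Complex.ofReal_mem_slitPlane.mpr hx
  have hx' : (x : ℂ) ≠ 0 := by exact_mod_cast hx.ne'
  have h1 := hasDerivAt_cpow_mul_besselEntire (m + 1 / 2 - 1) (2 * m) β hz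
  have h2 := hasDerivAt_cpow_mul_besselEntire (m + 1 / 2) (2 * m + 1) β hz
  have h := ((((h1.const_mul (m + 1 / 2)).sub (h2.const_mul β)).const_mul
    ((Real.pi : ℂ) ^ ((1 : ℂ) / 2) * β ^ (m + 1 / 4))).comp_ofReal).congr_of_eventuallyEq
    (f₁ := deriv (jfun β m)) (by
      filter_upwards [lt_mem_nhds hx] with y hy using (hasDerivAt_jfun m hβ hy).deriv)
  refine h.congr_deriv ?_
  have hrec := besselEntire_recurrence (2 * m) (β * x)
  rw [jfun_eq m hβ hx, show 2 * m + 1 + 1 = 2 * m + 2 by ring, Complex.cpow_sub _ 1 hx',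
    Complex.cpow_sub _ 1 hx', Complex.cpow_one]
  generalize (Real.pi : ℂ) ^ ((1 : ℂ) / 2) * β ^ (m + 1 / 4) = C
  generalize (x : ℂ) ^ (m + 1 / 2) = X
  generalize besselEntire (2 * m) (β * x) = F₀ at *
  generalize besselEntire (2 * m + 1) (β * x) = F₁ at *
  generalize besselEntire (2 * m + 2) (β * x) = F₂ at *
  field_simp
  linear_combination (16 * C * X * x * β) * hrec

/-- For `β ∉ (−∞,0]`, the function `j_{β,m}` is twice differentiable on `(0,∞)` and
satisfies the zero-energy Whittaker equation
`-j'' + (m²-1/4) x⁻² j - (β/x) j = 0` there. -/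
theorem jfun_twice_differentiable_and_zero_energy_eq (m β : ℂ)
    (hβ : β ∈ Complex.slitPlane) :
    (∀ x : ℝ, 0 < x →
      DifferentiableAt ℝ (jfun β m) x ∧
      DifferentiableAt ℝ (deriv (jfun β m)) x) ∧
    (∀ x : ℝ, 0 < x →
      -(deriv (deriv (jfun β m)) x)
        + (m ^ 2 - 1 / 4) * ((x : ℂ) ^ 2)⁻¹ * jfun β m x
        - β / (x : ℂ) * jfun β m x = 0) := by
  have hβ0 := Complex.slitPlane_ne_zero hβ
  refine ⟨fun x hx => ⟨(hasDerivAt_jfun m hβ0 hx).differentiableAt,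
    (hasDerivAt_deriv_jfun m hβ0 hx).differentiableAt⟩, fun x hx => ?_⟩
  rw [(hasDerivAt_deriv_jfun m hβ0 hx).deriv]
  ring
end

section
/- Let m, β ∈ ℂ with Re(m) > −1, let N ∈ ℕ with N + m + 1/2 ≠ 0, set k := β/(2(N+m+1/2)), and assume Re(k) > 0. Then the function f(x) := x^{1/2+m}·e^{−kx}·L_N^{(2m)}(2kx) on (0,∞) is not identically zero, is square-integrable on (0,∞), and satisfies for every x > 0 the eigenvalue equation −f''(x) + (m² − 1/4)·x^{−2}·f(x) − (β/x)·f(x) = λ_N·f(x), where λ_N := −β²/(4(N+m+1/2)²) = −k². -/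
/-- The eigenfunction `f(x) = x^{1/2+m} e^{−kx} L_N^{(2m)}(2kx)` on `(0,∞)`. -/
noncomputable def eigf (m k : ℂ) (N : ℕ) (x : ℝ) : ℂ :=
  (x : ℂ) ^ ((1 : ℂ) / 2 + m) * Complex.exp (-k * x) * lagC N (2 * m) (2 * k * x)

/-- The coefficient of `z ^ j` in the generalized Laguerre polynomial of degree `n`. -/
noncomputable def lagCoeff (n : ℕ) (α : ℂ) (j : ℕ) : ℂ :=
  (-1) ^ j * Complex.Gamma (n + α + 1) /
    (Complex.Gamma (j + α + 1) * (Nat.factorial (n - j)) * (Nat.factorial j))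

/-- The generalized Laguerre polynomial as an element of `ℂ[X]`. -/
noncomputable def lagPoly (n : ℕ) (α : ℂ) : Polynomial ℂ :=
  ∑ j ∈ Finset.range (n + 1), Polynomial.monomial j (lagCoeff n α j)

theorem lagPoly_coeff (n : ℕ) (α : ℂ) (j : ℕ) :
    (lagPoly n α).coeff j = if j ≤ n then lagCoeff n α j else 0 := by
  simp [lagPoly, Polynomial.coeff_monomial]

theorem lagC_eq_sum (n : ℕ) (α z : ℂ) :
    lagC n α z = ∑ j ∈ Finset.range (n + 1), lagCoeff n α j * z ^ j := by
  refine Finset.sum_congr rfl fun j _ => ?_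
  rw [lagCoeff]
  ring

theorem lagC_eq_eval (n : ℕ) (α z : ℂ) : lagC n α z = (lagPoly n α).eval z := by
  simp [lagC_eq_sum, lagPoly, Polynomial.eval_finsetSum]

theorem lagCoeff_succ (n : ℕ) (α : ℂ) {j : ℕ} (hj : j < n) :
    ((j : ℂ) + 1) * (j + α + 1) * lagCoeff n α (j + 1) = -((n : ℂ) - j) * lagCoeff n α j := by
  obtain ⟨d, rfl⟩ := Nat.exists_eq_add_of_lt hj
  have h := Complex.one_div_Gamma_eq_self_mul_one_div_Gamma_add_one ((j : ℂ) + α + 1)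
  have e1 : j + d + 1 - j = d + 1 := by omega
  have e2 : j + d + 1 - (j + 1) = d := by omega
  have e3 : ((j + 1 : ℕ) : ℂ) + α + 1 = (j : ℂ) + α + 1 + 1 := by push_cast; ring
  have hd : ((d : ℂ) + 1) ≠ 0 := Nat.cast_add_one_ne_zero d
  have hj' : ((j : ℂ) + 1) ≠ 0 := Nat.cast_add_one_ne_zero j
  have hd' : (Nat.factorial d : ℂ) ≠ 0 := Nat.cast_ne_zero.2 (Nat.factorial_ne_zero d)
  have hj'' : (Nat.factorial j : ℂ) ≠ 0 := Nat.cast_ne_zero.2 (Nat.factorial_ne_zero j)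
  simp only [lagCoeff, e1, e2, e3, Nat.factorial_succ, div_eq_mul_inv, mul_inv] at h ⊢
  rw [h]
  push_cast
  field_simp
  ring

theorem lagPoly_differential_equation (n : ℕ) (α : ℂ) :
    Polynomial.X * (lagPoly n α).derivative.derivative
      + (Polynomial.C (α + 1) - Polynomial.X) * (lagPoly n α).derivative
      + Polynomial.C (n : ℂ) * lagPoly n α = 0 := by
  have key : ∀ j : ℕ, ((j : ℂ) + 1) * (j + α + 1) * (lagPoly n α).coeff (j + 1)
      = -((n : ℂ) - j) * (lagPoly n α).coeff j := by
    intro j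
    rcases lt_trichotomy j n with h | rfl | h
    · simp only [lagPoly_coeff, h.le, Nat.succ_le_of_lt h, if_true]
      exact lagCoeff_succ n α h
    · simp [lagPoly_coeff]
    · simp [lagPoly_coeff, not_le.2 h, not_le.2 (h.trans (Nat.lt_succ_self j))]
  ext j
  have h := key j
  cases j with
  | zero =>
    simp [sub_mul, add_mul, Polynomial.coeff_derivative] at h ⊢
    linear_combination h
  | succ j =>
    simp [sub_mul, add_mul, Polynomial.coeff_derivative] at h ⊢
    linear_combination h

theorem lagPoly_ne_zero {n : ℕ} {α : ℂ} (h : Complex.Gamma (n + α + 1) ≠ 0) :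
    lagPoly n α ≠ 0 := by
  intro h0
  have h1 := lagPoly_coeff n α n
  rw [h0] at h1
  have h2 : (Nat.factorial n : ℂ) ≠ 0 := Nat.cast_ne_zero.2 (Nat.factorial_ne_zero n)
  rw [if_pos le_rfl, lagCoeff, Nat.sub_self, Polynomial.coeff_zero] at h1
  refine div_ne_zero (mul_ne_zero ?_ h) (mul_ne_zero (mul_ne_zero h ?_) h2) h1.symm <;> simp

theorem Gamma_degree_ne_zero {m : ℂ} (hm : -1 < m.re) {N : ℕ}
    (hN : (N : ℂ) + m + 1 / 2 ≠ 0) : Complex.Gamma (N + 2 * m + 1) ≠ 0 := by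
  refine Complex.Gamma_ne_zero fun j hj => ?_
  have hre : (N : ℝ) + 2 * m.re + 1 = -(j : ℝ) := by simpa using congrArg Complex.re hj
  have hlt : (N + j : ℝ) < 1 := by linarith
  have h0 : N + j < 1 := by exact_mod_cast hlt
  obtain ⟨rfl, rfl⟩ : N = 0 ∧ j = 0 := by omega
  apply hN
  simp only [Nat.cast_zero] at hj ⊢
  linear_combination hj / 2

theorem hasDerivAt_cpow_mul_exp_mul_eval (s k : ℂ) (P : Polynomial ℂ) {x : ℝ} (hx : 0 < x) :
    HasDerivAt (fun y : ℝ => (y : ℂ) ^ s * Complex.exp (-k * y) * P.eval (2 * k * y))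
      (s * ((x : ℂ) ^ (s - 1) * Complex.exp (-k * x) * P.eval (2 * k * x))
        - k * ((x : ℂ) ^ s * Complex.exp (-k * x) * P.eval (2 * k * x))
        + 2 * k * ((x : ℂ) ^ s * Complex.exp (-k * x) * P.derivative.eval (2 * k * x))) x := by
  have hs : (x : ℂ) ∈ Complex.slitPlane := Complex.ofReal_mem_slitPlane.2 hx
  have h1 : HasDerivAt (fun z : ℂ => z ^ s) (s * (x : ℂ) ^ (s - 1) * 1) (x : ℂ) :=
    (hasDerivAt_id (x : ℂ)).cpow_const hs
  have h2 : HasDerivAt (fun z : ℂ => Complex.exp (-k * z))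
      (Complex.exp (-k * x) * (-k * 1)) (x : ℂ) :=
    ((hasDerivAt_id (x : ℂ)).const_mul (-k)).cexp
  have h3 : HasDerivAt (fun z : ℂ => P.eval (2 * k * z))
      (P.derivative.eval (2 * k * x) * (2 * k * 1)) (x : ℂ) :=
    (P.hasDerivAt (2 * k * (x : ℂ))).comp (x : ℂ) ((hasDerivAt_id (x : ℂ)).const_mul (2 * k))
  refine ((h1.mul h2).mul h3).comp_ofReal.congr_deriv ?_
  simp only [Pi.mul_apply]
  ring

theorem deriv_deriv_cpow_mul_exp_mul_eval (s k : ℂ) (P : Polynomial ℂ) {x : ℝ} (hx : 0 < x) :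
    deriv (deriv fun y : ℝ => (y : ℂ) ^ s * Complex.exp (-k * y) * P.eval (2 * k * y)) x
      = (x : ℂ) ^ s * Complex.exp (-k * x) *
        ((s * (s - 1) / (x : ℂ) ^ 2 - 2 * s * k / x + k ^ 2) * P.eval (2 * k * x)
          + (4 * s * k / x - 4 * k ^ 2) * P.derivative.eval (2 * k * x)
          + 4 * k ^ 2 * P.derivative.derivative.eval (2 * k * x)) := by
  have h : deriv (fun y : ℝ => (y : ℂ) ^ s * Complex.exp (-k * y) * P.eval (2 * k * y))
      =ᶠ[nhds x] fun y : ℝ =>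
        s * ((y : ℂ) ^ (s - 1) * Complex.exp (-k * y) * P.eval (2 * k * y))
        - k * ((y : ℂ) ^ s * Complex.exp (-k * y) * P.eval (2 * k * y))
        + 2 * k * ((y : ℂ) ^ s * Complex.exp (-k * y) * P.derivative.eval (2 * k * y)) := by
    filter_upwards [lt_mem_nhds hx] with y hy
    exact (hasDerivAt_cpow_mul_exp_mul_eval s k P hy).deriv
  have hx0 : (x : ℂ) ≠ 0 := Complex.ofReal_ne_zero.2 hx.ne'
  rw [h.deriv_eq]
  have hd := (((hasDerivAt_cpow_mul_exp_mul_eval (s - 1) k P hx).const_mul s).sub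
    ((hasDerivAt_cpow_mul_exp_mul_eval s k P hx).const_mul k)).add
    ((hasDerivAt_cpow_mul_exp_mul_eval s k P.derivative hx).const_mul (2 * k))
  refine hd.deriv.trans ?_
  simp only [Complex.cpow_sub _ _ hx0, Complex.cpow_one]
  field_simp
  ring

theorem memLp_cpow_mul_exp {s k : ℂ} (hs : -1 / 2 < s.re) (hk : 0 < k.re) :
    MeasureTheory.MemLp (fun x : ℝ => (x : ℂ) ^ s * Complex.exp (-k * x)) 2
      (MeasureTheory.volume.restrict (Set.Ioi 0)) := by
  have hc : ContinuousOn (fun x : ℝ => (x : ℂ) ^ s * Complex.exp (-k * x)) (Set.Ioi 0) :=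
    fun x hx => (by simpa using
      (hasDerivAt_cpow_mul_exp_mul_eval s k 1 hx).continuousAt.continuousWithinAt)
  rw [MeasureTheory.memLp_two_iff_integrable_sq_norm
    (hc.aestronglyMeasurable measurableSet_Ioi)]
  have h := integrableOn_rpow_mul_exp_neg_mul_rpow (p := 1) (s := 2 * s.re) (b := 2 * k.re)
    (by linarith) one_pos (by linarith)
  refine MeasureTheory.IntegrableOn.congr_fun h (fun x hx => ?_) measurableSet_Ioi
  have hx : 0 < x := hx
  simp only [norm_mul, Complex.norm_cpow_eq_rpow_re_of_pos hx, Complex.norm_exp, mul_pow,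
    Real.rpow_one]
  rw [← Real.rpow_natCast (x ^ s.re), ← Real.rpow_mul hx.le, ← Real.exp_nat_mul]
  congr 2
  · push_cast; ring
  · simp; ring

theorem memLp_eigf {m k : ℂ} (hm : -1 < m.re) (hk : 0 < k.re) (N : ℕ) :
    MeasureTheory.MemLp (eigf m k N) 2 (MeasureTheory.volume.restrict (Set.Ioi 0)) := by
  have h : MeasureTheory.MemLp (fun x : ℝ => ∑ j ∈ Finset.range (N + 1),
      lagCoeff N (2 * m) j * (2 * k) ^ j *
        ((x : ℂ) ^ ((1 : ℂ) / 2 + m + j) * Complex.exp (-k * x))) 2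
      (MeasureTheory.volume.restrict (Set.Ioi 0)) := by
    refine MeasureTheory.memLp_finsetSum _ fun j _ => (memLp_cpow_mul_exp ?_ hk).const_mul _
    have : (0 : ℝ) ≤ j := j.cast_nonneg
    simp
    linarith
  refine h.ae_eq ?_
  filter_upwards [MeasureTheory.ae_restrict_mem measurableSet_Ioi] with x hx
  have hx0 : (x : ℂ) ≠ 0 := Complex.ofReal_ne_zero.2 (ne_of_gt hx)
  rw [eigf, lagC_eq_sum, Finset.mul_sum]
  refine Finset.sum_congr rfl fun j _ => ?_
  rw [Complex.cpow_add _ _ hx0, Complex.cpow_natCast]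
  ring

theorem eigf_not_identically_zero {m k : ℂ} (hm : -1 < m.re) {N : ℕ}
    (hN : (N : ℂ) + m + 1 / 2 ≠ 0) (hk : k ≠ 0) : ¬ ∀ x : ℝ, 0 < x → eigf m k N x = 0 := by
  intro h
  refine lagPoly_ne_zero (Gamma_degree_ne_zero hm hN) (Polynomial.eq_zero_of_infinite_isRoot _ ?_)
  have hinj : Function.Injective fun x : ℝ => 2 * k * (x : ℂ) :=
    fun x y hxy => Complex.ofReal_injective (mul_left_cancel₀ (mul_ne_zero two_ne_zero hk) hxy)
  refine ((Set.Ioi_infinite (0 : ℝ)).image hinj.injOn).mono ?_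
  rintro _ ⟨x, hx, rfl⟩
  have hx0 : (x : ℂ) ≠ 0 := Complex.ofReal_ne_zero.2 (ne_of_gt hx)
  have hz := h x hx
  rw [eigf, lagC_eq_eval] at hz
  exact (mul_eq_zero.1 hz).resolve_left
    (mul_ne_zero (by simp [Complex.cpow_eq_zero_iff, hx0]) (Complex.exp_ne_zero _))

/-- Let `Re m > −1`, `N + m + 1/2 ≠ 0`, `k = β/(2(N+m+1/2))` with `Re k > 0`.
Then `f(x) = x^{1/2+m} e^{−kx} L_N^{(2m)}(2kx)` is not identically zero on `(0,∞)`,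
is square-integrable on `(0,∞)`, and satisfies
`−f'' + (m²−1/4) x⁻² f − (β/x) f = λ_N f` with `λ_N = −β²/(4(N+m+1/2)²)`. -/
theorem eigf_eigenvalue_equation (m β : ℂ) (hm : -1 < m.re) (N : ℕ)
    (hN : (N : ℂ) + m + 1 / 2 ≠ 0) (k : ℂ)
    (hk : k = β / (2 * ((N : ℂ) + m + 1 / 2))) (hkre : 0 < k.re) :
    (¬ ∀ x : ℝ, 0 < x → eigf m k N x = 0) ∧
    MeasureTheory.IntegrableOn (fun x : ℝ => ‖eigf m k N x‖ ^ 2) (Set.Ioi 0) ∧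
    (∀ x : ℝ, 0 < x →
      -(deriv (deriv (eigf m k N)) x)
        + (m ^ 2 - 1 / 4) * ((x : ℂ) ^ 2)⁻¹ * eigf m k N x
        - β / (x : ℂ) * eigf m k N x
      = (-β ^ 2 / (4 * ((N : ℂ) + m + 1 / 2) ^ 2)) * eigf m k N x) := by
  have hβ : β = 2 * k * ((N : ℂ) + m + 1 / 2) := by
    have h := (eq_div_iff (mul_ne_zero two_ne_zero hN)).1 hk
    linear_combination -h
  have hk0 : k ≠ 0 := by
    rintro rfl
    simp at hkre
  refine ⟨eigf_not_identically_zero hm hN hk0, (memLp_eigf hm hkre N).norm.integrable_sq, ?_⟩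
  intro x hx
  have hx0 : (x : ℂ) ≠ 0 := Complex.ofReal_ne_zero.2 hx.ne'
  have hf : eigf m k N = fun y : ℝ => (y : ℂ) ^ ((1 : ℂ) / 2 + m) * Complex.exp (-k * y) *
      (lagPoly N (2 * m)).eval (2 * k * y) := by
    funext y
    rw [eigf, lagC_eq_eval]
  have hode := congrArg (Polynomial.eval (2 * k * (x : ℂ)))
    (lagPoly_differential_equation N (2 * m))
  simp only [Polynomial.eval_add, Polynomial.eval_mul, Polynomial.eval_sub, Polynomial.eval_X,
    Polynomial.eval_C, Polynomial.eval_zero] at hode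
  have hlam : -β ^ 2 / (4 * ((N : ℂ) + m + 1 / 2) ^ 2) = -k ^ 2 := by
    rw [hk]
    field_simp
    norm_num
  rw [hlam, hf, deriv_deriv_cpow_mul_exp_mul_eval _ _ _ hx, hβ]
  beta_reduce
  generalize (lagPoly N (2 * m)).eval (2 * k * (x : ℂ)) = p at hode ⊢
  generalize (lagPoly N (2 * m)).derivative.eval (2 * k * (x : ℂ)) = p' at hode ⊢
  generalize (lagPoly N (2 * m)).derivative.derivative.eval (2 * k * (x : ℂ)) = p'' at hode ⊢
  generalize (x : ℂ) ^ ((1 : ℂ) / 2 + m) * Complex.exp (-k * x) = E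
  have hx2 : (x : ℂ) * (x : ℂ)⁻¹ = 1 := mul_inv_cancel₀ hx0
  simp only [div_eq_mul_inv, ← inv_pow]
  linear_combination (-2 * k * (x : ℂ)⁻¹ * E) * hode
    + E * (4 * k ^ 2 * p'' - 4 * k ^ 2 * p') * hx2
end

section
/- Let β ∈ ℝ and m ∈ ℂ with Re(m) > −1 and Re(m) ≠ −1/2. Then for every k > 0 the value g_{β,m}(k) is well defined (the arguments of Γ avoid its poles) and nonzero, and there exist constants 0 < c ≤ C such that c ≤ |g_{β,m}(k)| ≤ C for all k > 0. -/
/-- The intrinsic scattering symbol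
`g_{β,m}(k) = e^{−iπm} Γ(1/2+m−iβ/(2k)) / Γ(1/2+m+iβ/(2k))`. -/
noncomputable def gfun (β m : ℂ) (k : ℝ) : ℂ :=
  Complex.exp (-(Real.pi : ℂ) * Complex.I * m) *
    Complex.Gamma (1 / 2 + m - Complex.I * β / (2 * k)) /
    Complex.Gamma (1 / 2 + m + Complex.I * β / (2 * k))

theorem sum_add_div_sq_add_sq_le {a B y : ℝ} (ha : -1 / 2 < a) (hB : 0 ≤ B) (hy : 0 ≤ y)
    (n : ℕ) :
    ∑ j ∈ Finset.range n, (y + B) / ((a + (j + 1 : ℕ)) ^ 2 + y ^ 2) ≤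
      2 * (1 + B / (a + 1 / 2)) := by
  have ha' : 0 < a + 1 / 2 := by linarith
  have key : ∀ n : ℕ, ∑ j ∈ Finset.range n, (y + B) / ((a + (j + 1 : ℕ)) ^ 2 + y ^ 2) ≤
      2 * (y + B) * (1 / (a + 1 / 2 + y) - 1 / (a + 1 / 2 + y + n)) := by
    intro n
    induction n with
    | zero => simp
    | succ n ih =>
      rw [Finset.sum_range_succ]
      have hn : (0 : ℝ) ≤ n := n.cast_nonneg
      have hw : 0 < a + 1 / 2 + y + n := by linarith
      have hx : 0 < a + 1 + n := by linarith
      have hden : 0 < (a + (n + 1 : ℕ)) ^ 2 + y ^ 2 := by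
        push_cast
        nlinarith [mul_pos hx hx, sq_nonneg y]
      have step : (y + B) / ((a + (n + 1 : ℕ)) ^ 2 + y ^ 2) ≤
          2 * (y + B) * (1 / (a + 1 / 2 + y + n) - 1 / (a + 1 / 2 + y + (n + 1 : ℕ))) := by
        have : 1 / (a + 1 / 2 + y + n) - 1 / (a + 1 / 2 + y + (n + 1 : ℕ)) =
            1 / ((a + 1 / 2 + y + n) * (a + 1 / 2 + y + n + 1)) := by
          push_cast
          rw [← add_assoc]
          generalize a + 1 / 2 + y + n = w at hw
          field_simp
          ring
        rw [this, mul_one_div, div_le_div_iff₀ hden (by positivity)]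
        have h : (a + 1 / 2 + y + n) * (a + 1 / 2 + y + n + 1) ≤
            2 * ((a + (n + 1 : ℕ)) ^ 2 + y ^ 2) := by
          push_cast
          nlinarith [sq_nonneg (a + (n + 1) - y)]
        nlinarith [mul_le_mul_of_nonneg_left h (add_nonneg hy hB)]
      linarith
  refine (key n).trans ?_
  have h1 : 0 ≤ 1 / (a + 1 / 2 + y + n) := by positivity
  have h2 : (y + B) * (1 / (a + 1 / 2 + y)) ≤ 1 + B / (a + 1 / 2) := by
    rw [mul_one_div, add_div]
    exact add_le_add (div_le_one_of_le₀ (by linarith) (by positivity))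
      (div_le_div_of_nonneg_left hB ha' (by linarith))
  nlinarith [mul_nonneg (add_nonneg hy hB) h1]

theorem exists_sum_add_div_sq_add_sq_le {a B : ℝ} (ha : -1 / 2 < a) (ha0 : a ≠ 0)
    (hB : 0 ≤ B) :
    ∃ K : ℝ, ∀ y : ℝ, 0 ≤ y → ∀ n : ℕ,
      ∑ j ∈ Finset.range (n + 1), (y + B) / ((a + j) ^ 2 + y ^ 2) ≤ K := by
  refine ⟨2 * (1 + B / (a + 1 / 2)) + (1 / |a| + B / a ^ 2), fun y hy n => ?_⟩
  rw [Finset.sum_range_succ']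
  refine add_le_add (sum_add_div_sq_add_sq_le ha hB hy n) ?_
  have hpos : 0 < |a| := abs_pos.2 ha0
  simp only [Nat.cast_zero, add_zero, add_div]
  refine add_le_add ?_ (div_le_div_of_nonneg_left hB (by positivity) (by nlinarith [sq_nonneg y]))
  rw [div_le_div_iff₀ (by positivity) hpos, ← sq_abs a]
  nlinarith [sq_nonneg (|a| - y), sq_nonneg |a|, sq_nonneg y]

/-- On a vertical line `re s = a` with `a > -1/2`, `a ≠ 0`, moving the imaginary part by a bounded
amount changes `‖Γ s‖` at most by a bounded factor. -/
theorem Complex.exists_norm_Gamma_le_mul {a δ : ℝ} (ha : -1 / 2 < a) (ha0 : a ≠ 0)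
    (hδ : 0 ≤ δ) :
    ∃ C : ℝ, 0 < C ∧ ∀ s t : ℂ, s.re = a → t.re = a → |t.im| ≤ |s.im| + δ →
      ‖Complex.Gamma s‖ ≤ C * ‖Complex.Gamma t‖ := by
  obtain ⟨K, hK⟩ := exists_sum_add_div_sq_add_sq_le ha ha0 hδ
  refine ⟨Real.exp (δ * K), Real.exp_pos _, fun s t hs ht hst => ?_⟩
  have hne : ∀ j : ℕ, a + j ≠ 0 := by
    rintro (_ | j)
    · simpa using ha0
    · push_cast
      have : (0 : ℝ) ≤ j := j.cast_nonneg
      intro h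
      linarith
  have normSq_add : ∀ (z : ℂ) (j : ℕ), z.re = a → ‖z + j‖ ^ 2 = (a + j) ^ 2 + |z.im| ^ 2 := by
    intro z j hz
    rw [Complex.sq_norm, Complex.normSq_apply, sq_abs]
    simp [hz]
    ring
  have norm_pos : ∀ (z : ℂ) (j : ℕ), z.re = a → 0 < ‖z + j‖ := by
    intro z j hz
    refine norm_pos_iff.2 fun h => hne j ?_
    simpa [hz] using congrArg Complex.re h
  have factor : ∀ j : ℕ, ‖t + j‖ ≤
      ‖s + j‖ * Real.exp (δ * ((|s.im| + δ) / ((a + j) ^ 2 + |s.im| ^ 2))) := by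
    intro j
    refine le_of_sq_le_sq ?_ (by positivity)
    have hD : 0 < (a + j) ^ 2 + |s.im| ^ 2 := by
      have := hne j
      positivity
    rw [mul_pow, ← Real.exp_nat_mul, normSq_add t j ht, normSq_add s j hs]
    have hexp := Real.add_one_le_exp
      (((2 : ℕ) : ℝ) * (δ * ((|s.im| + δ) / ((a + j) ^ 2 + |s.im| ^ 2))))
    refine le_trans ?_ (mul_le_mul_of_nonneg_left hexp hD.le)
    have : ((a + j) ^ 2 + |s.im| ^ 2) *
        (((2 : ℕ) : ℝ) * (δ * ((|s.im| + δ) / ((a + j) ^ 2 + |s.im| ^ 2))) + 1) =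
        (a + j) ^ 2 + |s.im| ^ 2 + 2 * δ * (|s.im| + δ) := by
      push_cast
      field_simp
      ring
    rw [this]
    nlinarith [pow_le_pow_left₀ (abs_nonneg _) hst 2, sq_nonneg δ]
  have prod_le : ∀ n : ℕ, ∏ j ∈ Finset.range (n + 1), ‖t + j‖ ≤
      Real.exp (δ * K) * ∏ j ∈ Finset.range (n + 1), ‖s + j‖ := by
    intro n
    refine (Finset.prod_le_prod (fun _ _ => norm_nonneg _) fun j _ => factor j).trans ?_
    rw [Finset.prod_mul_distrib, ← Real.exp_sum, ← Finset.mul_sum, mul_comm]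
    gcongr
    exact hK _ (abs_nonneg _) n
  refine le_of_tendsto_of_tendsto (Complex.GammaSeq_tendsto_Gamma s).norm
    ((Complex.GammaSeq_tendsto_Gamma t).norm.const_mul _) ?_
  filter_upwards [Filter.eventually_gt_atTop 0] with n hn
  simp only [Complex.GammaSeq, norm_div, norm_mul, norm_prod,
    Complex.norm_natCast_cpow_of_pos hn, hs, ht]
  have hPs : 0 < ∏ j ∈ Finset.range (n + 1), ‖s + j‖ :=
    Finset.prod_pos fun j _ => norm_pos s j hs
  have hPt : 0 < ∏ j ∈ Finset.range (n + 1), ‖t + j‖ :=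
    Finset.prod_pos fun j _ => norm_pos t j ht
  rw [← mul_div_assoc, div_le_div_iff₀ hPs hPt]
  refine (mul_le_mul_of_nonneg_left (prod_le n) (by positivity)).trans_eq ?_
  ring

/-- For real `β` and `Re m > −1` with `Re m ≠ −1/2`, the function `g_{β,m}` is
well defined (the arguments of `Γ` avoid its poles) and nonzero at every `k > 0`,
and `|g_{β,m}|` is bounded above and below by positive constants on `(0,∞)`. -/
theorem gfun_bounded_real_beta (β : ℝ) (m : ℂ) (h1 : -1 < m.re) (h2 : m.re ≠ -1 / 2) :
    (∀ k : ℝ, 0 < k →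
      Complex.Gamma (1 / 2 + m - Complex.I * (β : ℂ) / (2 * k)) ≠ 0 ∧
      Complex.Gamma (1 / 2 + m + Complex.I * (β : ℂ) / (2 * k)) ≠ 0 ∧
      gfun (β : ℂ) m k ≠ 0) ∧
    ∃ c C : ℝ, 0 < c ∧ c ≤ C ∧
      ∀ k : ℝ, 0 < k → c ≤ ‖gfun (β : ℂ) m k‖ ∧ ‖gfun (β : ℂ) m k‖ ≤ C := by
  have hre : ∀ k : ℝ, (1 / 2 + m - Complex.I * (β : ℂ) / (2 * k)).re = 1 / 2 + m.re ∧
      (1 / 2 + m - Complex.I * (β : ℂ) / (2 * k)).im = m.im - β / (2 * k) ∧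
      (1 / 2 + m + Complex.I * (β : ℂ) / (2 * k)).re = 1 / 2 + m.re ∧
      (1 / 2 + m + Complex.I * (β : ℂ) / (2 * k)).im = m.im + β / (2 * k) := by
    intro k
    have h : Complex.I * (β : ℂ) / (2 * k) = ((β / (2 * k) : ℝ) : ℂ) * Complex.I := by
      push_cast
      ring
    rw [h]
    refine ⟨?_, ?_, ?_, ?_⟩ <;> simp [-Complex.ofReal_div]
  have ha : -1 / 2 < 1 / 2 + m.re := by linarith
  have ha0 : 1 / 2 + m.re ≠ 0 := fun h => h2 (by linarith)
  have hΓ : ∀ s : ℂ, s.re = 1 / 2 + m.re → Complex.Gamma s ≠ 0 := by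
    refine fun s hs => Complex.Gamma_ne_zero fun j hj => ?_
    have hj' : s.re = -j := by simp [hj]
    rcases j with _ | j
    · exact ha0 (by simpa [hs] using hj')
    · have : (0 : ℝ) ≤ j := j.cast_nonneg
      push_cast at hj'
      linarith
  refine ⟨fun k _ => ?_, ?_⟩
  · obtain ⟨hr, -, hr', -⟩ := hre k
    exact ⟨hΓ _ hr, hΓ _ hr',
      div_ne_zero (mul_ne_zero (Complex.exp_ne_zero _) (hΓ _ hr)) (hΓ _ hr')⟩
  obtain ⟨C, hC, hbound⟩ := Complex.exists_norm_Gamma_le_mul ha ha0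
    (mul_nonneg zero_le_two (abs_nonneg m.im))
  set E := ‖Complex.exp (-(Real.pi : ℂ) * Complex.I * m)‖ with hE
  have hE0 : 0 < E := norm_pos_iff.2 (Complex.exp_ne_zero _)
  have hk : ∀ k : ℝ, 0 < k → E / C ≤ ‖gfun (β : ℂ) m k‖ ∧ ‖gfun (β : ℂ) m k‖ ≤ E * C := by
    intro k _
    obtain ⟨hr, hi, hr', hi'⟩ := hre k
    have hp := norm_pos_iff.2 (hΓ _ hr')
    have habs : ∀ x y : ℝ, |x + y| ≤ |x - y| + 2 * |x| ∧ |x - y| ≤ |x + y| + 2 * |x| := by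
      intro x y
      constructor <;> grind
    have hle := hbound _ _ hr hr' (by rw [hi, hi']; exact (habs _ _).1)
    have hge := hbound _ _ hr' hr (by rw [hi, hi']; exact (habs _ _).2)
    rw [gfun, norm_div, norm_mul, ← hE]
    constructor
    · rw [div_le_div_iff₀ hC hp, mul_assoc]
      gcongr
      linarith
    · rw [div_le_iff₀ hp, mul_assoc]
      gcongr
  exact ⟨E / C, E * C, by positivity, (hk 1 one_pos).1.trans (hk 1 one_pos).2, hk⟩
end

section
/- Let β, m ∈ ℂ with Im(β) ≠ 0. Then there do not exist constants 0 < c ≤ C such that c ≤ |g_{β,m}(k)| ≤ C for all k > 0 at which g_{β,m} is defined; that is, on (0,∞) either g_{β,m} is unbounded or 1/g_{β,m} is unbounded. -/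
open Filter in
theorem Complex.Gamma_re_mul_exp_le_norm_Gamma {s : ℂ} (hs : 1 < s.re) :
    Real.Gamma s.re * Real.exp (-(s.im ^ 2 / 2 * (1 / (s.re - 1)))) ≤ ‖Complex.Gamma s‖ := by
  set x := s.re with hx
  set y := s.im with hy
  have hfac : ∀ j : ℕ, ‖s + j‖ ≤
      (x + j) * Real.exp (y ^ 2 / 2 * (1 / (x + j - 1) - 1 / (x + j))) := by
    intro j
    have hj : (0 : ℝ) ≤ j := j.cast_nonneg
    have hpos : 0 < x + j := by linarith
    have hpos' : 0 < x + j - 1 := by linarith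
    apply le_of_sq_le_sq _ (by positivity)
    rw [Complex.sq_norm, Complex.normSq_apply, mul_pow, ← Real.exp_nat_mul]
    simp only [Complex.add_re, Complex.natCast_re, Complex.add_im, Complex.natCast_im, add_zero,
      ← hx, ← hy]
    have h1 : y ^ 2 / (x + j) ^ 2 ≤
        ((2 : ℕ) : ℝ) * (y ^ 2 / 2 * (1 / (x + j - 1) - 1 / (x + j))) := by
      have : ((2 : ℕ) : ℝ) * (y ^ 2 / 2 * (1 / (x + j - 1) - 1 / (x + j))) =
          y ^ 2 / ((x + j - 1) * (x + j)) := by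
        field_simp
        push_cast
        ring
      rw [this]
      apply div_le_div_of_nonneg_left (sq_nonneg y) (by positivity)
      nlinarith
    have h2 := Real.add_one_le_exp
      (((2 : ℕ) : ℝ) * (y ^ 2 / 2 * (1 / (x + j - 1) - 1 / (x + j))))
    calc (x + j) * (x + j) + y * y = (x + j) ^ 2 * (y ^ 2 / (x + j) ^ 2 + 1) := by
          field_simp
          ring
      _ ≤ _ := by gcongr; linarith
  have hprod : ∀ n : ℕ, ∏ j ∈ Finset.range n, ‖s + j‖ ≤ (∏ j ∈ Finset.range n, (x + j)) *
      Real.exp (y ^ 2 / 2 * (1 / (x - 1) - 1 / (x + n - 1))) := by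
    intro n
    induction n with
    | zero => simp
    | succ n ih =>
      have hn : (0 : ℝ) ≤ n := n.cast_nonneg
      have hP : 0 ≤ ∏ j ∈ Finset.range n, (x + (j : ℝ)) :=
        Finset.prod_nonneg fun j _ => by positivity
      rw [Finset.prod_range_succ, Finset.prod_range_succ]
      calc _ ≤ _ := mul_le_mul ih (hfac n) (norm_nonneg _) (by positivity)
        _ = (∏ j ∈ Finset.range n, (x + (j : ℝ))) * (x + n) *
            (Real.exp (y ^ 2 / 2 * (1 / (x - 1) - 1 / (x + n - 1))) *
              Real.exp (y ^ 2 / 2 * (1 / (x + n - 1) - 1 / (x + n)))) := by ring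
        _ = _ := by
          rw [← Real.exp_add]
          push_cast
          rw [show x + ((n : ℝ) + 1) - 1 = x + n by ring]
          ring_nf
  refine le_of_tendsto_of_tendsto ((Real.GammaSeq_tendsto_Gamma x).mul_const _)
    (Complex.GammaSeq_tendsto_Gamma s).norm ?_
  filter_upwards [eventually_gt_atTop 0] with n hn
  have hn' : (0 : ℝ) < n := by exact_mod_cast hn
  have hP : 0 < ∏ j ∈ Finset.range (n + 1), (x + (j : ℝ)) :=
    Finset.prod_pos fun j _ => by positivity
  have hQ : 0 < ∏ j ∈ Finset.range (n + 1), ‖s + j‖ := by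
    refine Finset.prod_pos fun j _ => norm_pos_iff.2 fun h => ?_
    have := congrArg Complex.re h
    have hj : (0 : ℝ) ≤ j := j.cast_nonneg
    simp only [Complex.add_re, Complex.natCast_re, Complex.zero_re] at this
    linarith
  have hle : ∏ j ∈ Finset.range (n + 1), ‖s + j‖ ≤ (∏ j ∈ Finset.range (n + 1), (x + j)) *
      Real.exp (y ^ 2 / 2 * (1 / (x - 1))) := by
    refine (hprod (n + 1)).trans ?_
    have : 0 ≤ 1 / (x + ((n + 1 : ℕ) : ℝ) - 1) := by
      push_cast
      apply one_div_nonneg.2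
      linarith
    gcongr
    linarith
  have hnorm : ‖Complex.GammaSeq s n‖ =
      (n : ℝ) ^ x * n.factorial / ∏ j ∈ Finset.range (n + 1), ‖s + j‖ := by
    rw [Complex.GammaSeq, norm_div, norm_mul, norm_prod, Complex.norm_natCast_cpow_of_pos hn,
      Complex.norm_natCast]
  rw [hnorm, Real.GammaSeq, le_div_iff₀ hQ, Real.exp_neg]
  calc _ ≤ (n : ℝ) ^ x * n.factorial / (∏ j ∈ Finset.range (n + 1), (x + (j : ℝ))) *
        (Real.exp (y ^ 2 / 2 * (1 / (x - 1))))⁻¹ * ((∏ j ∈ Finset.range (n + 1), (x + j)) *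
      Real.exp (y ^ 2 / 2 * (1 / (x - 1)))) := by gcongr
    _ = _ := by field_simp

open Filter in
theorem Real.tendsto_Gamma_mul_exp_neg_atTop (s M : ℝ) :
    Tendsto (fun n : ℕ => Real.Gamma (n + s) * Real.exp (-(M * (n + s)))) atTop atTop := by
  obtain ⟨N, hN⟩ := exists_nat_gt (2 * Real.exp M + |s|)
  have hs := neg_abs_le s
  have hM := Real.exp_pos M
  rw [← tendsto_add_atTop_iff_nat N]
  have hpos : ∀ n : ℕ, 2 * Real.exp M ≤ ((n + N : ℕ) : ℝ) + s := fun n => by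
    have : (0 : ℝ) ≤ n := n.cast_nonneg
    push_cast
    linarith
  refine tendsto_atTop_of_geom_le (c := 2) ?_ one_lt_two fun n => ?_
  · exact mul_pos (Real.Gamma_pos_of_pos (by linarith [hpos 0])) (Real.exp_pos _)
  · have h := hpos n
    have hx : ((n + 1 + N : ℕ) : ℝ) + s = ((n + N : ℕ) : ℝ) + s + 1 := by
      push_cast
      ring
    rw [hx]
    set x := ((n + N : ℕ) : ℝ) + s
    have hx0 : 0 < x := by linarith
    have hG := Real.Gamma_pos_of_pos hx0
    rw [Real.Gamma_add_one hx0.ne', show -(M * (x + 1)) = -(M * x) + -M by ring, Real.exp_add,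
      Real.exp_neg M]
    have h2 : 2 ≤ x * (Real.exp M)⁻¹ := by
      rw [← div_eq_mul_inv, le_div_iff₀ hM]
      exact h
    calc _ ≤ x * (Real.exp M)⁻¹ * (Real.Gamma x * Real.exp (-(M * x))) := by gcongr
      _ = _ := by ring

open Filter in
theorem Complex.tendsto_norm_Gamma_atTop_of_affine {z : ℕ → ℂ} {s p q : ℝ}
    (hre : ∀ n, (z n).re = n + s) (him : ∀ n, (z n).im = p + q * n) :
    Tendsto (fun n => ‖Complex.Gamma (z n)‖) atTop atTop := by
  refine tendsto_atTop_mono' _ ?_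
    (Real.tendsto_Gamma_mul_exp_neg_atTop s ((|q| + 1) ^ 2))
  filter_upwards [tendsto_natCast_atTop_atTop.eventually_ge_atTop
    (|p| + (|q| + 1) * |s| + |s| + 2)] with n hn
  have hs := neg_abs_le s
  have hp := abs_nonneg p
  have hq := abs_nonneg q
  have hx : 2 ≤ n + s := by nlinarith [abs_nonneg s]
  have hy : |p + q * n| ≤ (|q| + 1) * (n + s) := by
    have h1 := abs_add_le p (q * n)
    rw [abs_mul, Nat.abs_cast] at h1
    nlinarith [abs_nonneg s]
  refine le_trans ?_ (Complex.Gamma_re_mul_exp_le_norm_Gamma (s := z n) (by rw [hre]; linarith))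
  rw [hre, him]
  have hG := Real.Gamma_pos_of_pos (show 0 < n + s by linarith)
  refine mul_le_mul_of_nonneg_left (Real.exp_le_exp.2 (neg_le_neg ?_)) hG.le
  have hsq : (p + q * n) ^ 2 ≤ ((|q| + 1) * (n + s)) ^ 2 := by
    rw [← sq_abs]
    gcongr
  rw [mul_one_div, div_le_iff₀ (by linarith)]
  have h2 : 0 ≤ (|q| + 1) ^ 2 * (n + s) * (n + s - 2) :=
    mul_nonneg (by positivity) (by linarith)
  nlinarith

theorem Complex.one_le_norm_sin_of_re_eq {w : ℂ} {n : ℤ} (h : w.re = Real.pi / 2 + n * Real.pi) :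
    1 ≤ ‖Complex.sin w‖ := by
  have hc : Real.cos w.re = 0 := Real.cos_eq_zero_iff.2 ⟨n, by rw [h]; ring⟩
  have hs : |Real.sin w.re| = 1 := by
    rw [← sq_eq_sq₀ (abs_nonneg _) zero_le_one, sq_abs]
    nlinarith [Real.sin_sq_add_cos_sq w.re]
  rw [Complex.sin_eq, ← Complex.ofReal_cos, hc, ← Complex.ofReal_sin, ← Complex.ofReal_cosh]
  simp only [Complex.ofReal_zero, zero_mul, add_zero]
  rw [norm_mul, Complex.norm_real, Complex.norm_real, Real.norm_eq_abs, Real.norm_eq_abs, hs,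
    one_mul, abs_of_pos (Real.cosh_pos _)]
  exact Real.one_le_cosh _

open Filter in
theorem Complex.exists_lt_norm_Gamma_add_div_Gamma_sub (a u : ℂ) (hu : 0 < u.re) (C : ℝ) :
    ∃ t : ℝ, 0 < t ∧ Complex.Gamma (a + t * u) ≠ 0 ∧ Complex.Gamma (a - t * u) ≠ 0 ∧
      C < ‖Complex.Gamma (a + t * u) / Complex.Gamma (a - t * u)‖ := by
  let t : ℕ → ℝ := fun n => (n + 1 / 2 + a.re) / u.re
  have htu : ∀ n, t n * u.re = n + 1 / 2 + a.re := fun n => div_mul_cancel₀ _ hu.ne'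
  have h1 : Tendsto (fun n => ‖Complex.Gamma (a + t n * u)‖) atTop atTop := by
    refine Complex.tendsto_norm_Gamma_atTop_of_affine (s := 1 / 2 + 2 * a.re)
      (p := a.im + (1 / 2 + a.re) / u.re * u.im) (q := u.im / u.re) (fun n => ?_) fun n => ?_
    · simp [htu]
      ring
    · simp [t]
      ring
  have h2 : Tendsto (fun n => ‖Complex.Gamma (1 - (a - t n * u))‖) atTop atTop := by
    refine Complex.tendsto_norm_Gamma_atTop_of_affine (s := 3 / 2)
      (p := -a.im + (1 / 2 + a.re) / u.re * u.im) (q := u.im / u.re) (fun n => ?_) fun n => ?_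
    · simp [htu]
      ring
    · simp [t]
      ring
  have hn := tendsto_natCast_atTop_atTop (R := ℝ)
  obtain ⟨n, hn1, hn2, hn3⟩ := (((h1.atTop_mul_atTop₀ h2).eventually_gt_atTop (Real.pi * C)).and
    ((h1.eventually_gt_atTop 0).and (hn.eventually_gt_atTop |a.re|))).exists
  have hre : (a - t n * u).re = -n - 1 / 2 := by
    simp [htu]
    ring
  have hne : Complex.Gamma (a - t n * u) ≠ 0 := by
    refine Complex.Gamma_ne_zero fun k hk => ?_
    rw [hk] at hre
    simp only [Complex.neg_re, Complex.natCast_re] at hre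
    have h : (2 * k : ℝ) = 2 * n + 1 := by linarith
    norm_cast at h
    omega
  refine ⟨t n, div_pos ?_ hu, norm_pos_iff.1 hn2, hne, ?_⟩
  · linarith [neg_abs_le a.re]
  have hsin : 1 ≤ ‖Complex.sin (Real.pi * (a - t n * u))‖ := by
    refine Complex.one_le_norm_sin_of_re_eq (n := -n - 1) ?_
    rw [Complex.re_ofReal_mul, hre]
    push_cast
    ring
  have hrefl := congrArg norm (Complex.Gamma_mul_Gamma_one_sub (a - t n * u))
  rw [norm_mul, norm_div, Complex.norm_real, Real.norm_eq_abs, abs_of_pos Real.pi_pos] at hrefl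
  have hle : ‖Complex.Gamma (a - t n * u)‖ * ‖Complex.Gamma (1 - (a - t n * u))‖ ≤ Real.pi := by
    rw [hrefl]
    exact div_le_self Real.pi_pos.le hsin
  have hpos := norm_pos_iff.2 hne
  rw [norm_div, lt_div_iff₀ hpos]
  have hG := norm_nonneg (Complex.Gamma (1 - (a - t n * u)))
  by_contra! hcon
  have hpi := Real.pi_pos
  rcases le_or_gt C 0 with hC | hC
  · nlinarith
  · have h3 := mul_le_mul_of_nonneg_right hcon hG
    have h4 := mul_le_mul_of_nonneg_left hle hC.le
    nlinarith

/-- If `Im β ≠ 0`, there are no constants `0 < c ≤ C` such that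
`c ≤ |g_{β,m}(k)| ≤ C` for all `k > 0` at which `g_{β,m}` is defined
(i.e. at which neither argument of `Γ` is a pole). -/
theorem gfun_not_bounded_complex_beta (β m : ℂ) (hβ : β.im ≠ 0) :
    ¬ ∃ c C : ℝ, 0 < c ∧ c ≤ C ∧
      ∀ k : ℝ, 0 < k →
        (Complex.Gamma (1 / 2 + m - Complex.I * β / (2 * k)) ≠ 0 ∧
         Complex.Gamma (1 / 2 + m + Complex.I * β / (2 * k)) ≠ 0) →
        c ≤ ‖gfun β m k‖ ∧ ‖gfun β m k‖ ≤ C := by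
  rintro ⟨c, C, hc, -, h⟩
  have hE : 0 < ‖Complex.exp (-(Real.pi : ℂ) * Complex.I * m)‖ :=
    norm_pos_iff.2 (Complex.exp_ne_zero _)
  have harg : ∀ t : ℝ, Complex.I * β / (2 * ((t⁻¹ : ℝ) : ℂ)) = t * (Complex.I * β / 2) := by
    intro t
    rw [Complex.ofReal_inv, mul_comm (2 : ℂ), ← div_div, div_inv_eq_mul]
    ring
  rcases lt_or_gt_of_ne hβ with hneg | hpos
  · obtain ⟨t, ht, h1, h2, h3⟩ := Complex.exists_lt_norm_Gamma_add_div_Gamma_sub (1 / 2 + m)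
      (Complex.I * β / 2) (by simp; linarith)
      (‖Complex.exp (-(Real.pi : ℂ) * Complex.I * m)‖ / c)
    have hb := (h t⁻¹ (inv_pos.2 ht) (by rw [harg]; exact ⟨h2, h1⟩)).1
    rw [gfun, harg, norm_div, norm_mul, le_div_iff₀ (norm_pos_iff.2 h1)] at hb
    rw [norm_div, div_lt_div_iff₀ hc (norm_pos_iff.2 h2)] at h3
    linarith
  · obtain ⟨t, ht, h1, h2, h3⟩ := Complex.exists_lt_norm_Gamma_add_div_Gamma_sub (1 / 2 + m)
      (-(Complex.I * β / 2)) (by simp; linarith)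
      (C / ‖Complex.exp (-(Real.pi : ℂ) * Complex.I * m)‖)
    rw [mul_neg, sub_neg_eq_add] at h2 h3
    rw [mul_neg] at h1
    rw [← sub_eq_add_neg] at h1 h3
    have hb := (h t⁻¹ (inv_pos.2 ht) (by rw [harg]; exact ⟨h1, h2⟩)).2
    rw [gfun, harg, mul_div_assoc, norm_mul] at hb
    rw [div_lt_iff₀ hE] at h3
    linarith
end

section
/- Let β, m ∈ ℂ with 1/2+m−β not a nonpositive integer. Then ℐ_{β,m}(x) = x^{−β}·e^{x/2}·(1 + O(1/x))/Γ(1/2+m−β) as x → ∞ along (0,∞); precisely, there exist C > 0 and x₀ > 0 such that for all x ≥ x₀, |Γ(1/2+m−β)·x^{β}·e^{−x/2}·ℐ_{β,m}(x) − 1| ≤ C/x, where x^{β} := exp(β·ln x). -/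
/-- The `k`-th term of the series `∑ Γ(a+k)/Γ(c+k) · x^k/k!`. -/
noncomputable def gammaRatioTerm (a c : ℂ) (k : ℕ) (x : ℝ) : ℂ :=
  Complex.Gamma (a + k) * (Complex.Gamma (c + k))⁻¹ * ((x : ℂ) ^ k / (Nat.factorial k))

/-- The series `∑ Γ(a+k)/Γ(c+k) · x^k/k!`, equal to `Γ(a) ₁𝐅₁(a;c;x)` away from the poles. -/
noncomputable def gammaRatioSeries (a c : ℂ) (x : ℝ) : ℂ :=
  ∑' k : ℕ, gammaRatioTerm a c k x

theorem succ_mul_gammaRatioTerm_succ (a c : ℂ) (k : ℕ) (x : ℝ) :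
    ((k + 1 : ℕ) : ℂ) * gammaRatioTerm a c (k + 1) x =
      x * gammaRatioTerm (a + 1) (c + 1) k x := by
  have hk : ((k : ℂ) + 1) ≠ 0 := Nat.cast_add_one_ne_zero k
  have hf : ((Nat.factorial k : ℕ) : ℂ) ≠ 0 := by exact_mod_cast Nat.factorial_ne_zero k
  have ha : a + ((k + 1 : ℕ) : ℂ) = a + 1 + k := by push_cast; ring
  have hc : c + ((k + 1 : ℕ) : ℂ) = c + 1 + k := by push_cast; ring
  simp only [gammaRatioTerm]
  rw [ha, hc, Nat.factorial_succ]
  push_cast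
  field_simp
  ring

theorem gammaRatioTerm_eq_mul_add_one (a c : ℂ) (k : ℕ) (x : ℝ) :
    gammaRatioTerm a c k x = (c + k) * gammaRatioTerm a (c + 1) k x := by
  simp only [gammaRatioTerm]
  rw [Complex.one_div_Gamma_eq_self_mul_one_div_Gamma_add_one (c + k),
    show c + k + 1 = c + 1 + k by ring]
  ring

theorem summable_gammaRatioTerm (a c : ℂ) (x : ℝ) :
    Summable fun k => gammaRatioTerm a c k x := by
  refine summable_of_ratio_norm_eventually_le (r := 1 / 2) (by norm_num) ?_
  filter_upwards [Filter.eventually_ge_atTop (⌈2 * (‖a‖ + ‖c‖) + 8 * |x| + 1⌉₊)] with k hk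
  have hk' : 2 * (‖a‖ + ‖c‖) + 8 * |x| + 1 ≤ k := Nat.ceil_le.mp hk
  have na := norm_nonneg a
  have nc := norm_nonneg c
  have nx := abs_nonneg x
  have hnk : ‖(k : ℂ)‖ = k := Complex.norm_natCast k
  have ha1 : ‖a + k‖ ≤ 2 * k := by
    have := norm_add_le a (k : ℂ)
    linarith
  have ha2 : a + k ≠ 0 := by
    intro h0
    have := norm_sub_norm_le (k : ℂ) (-a)
    rw [sub_neg_eq_add, add_comm (k : ℂ), norm_neg, h0, norm_zero] at this
    linarith
  have hc1 : (k : ℝ) / 2 ≤ ‖c + k‖ := by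
    have := norm_sub_norm_le (k : ℂ) (-c)
    rw [sub_neg_eq_add, add_comm (k : ℂ), norm_neg] at this
    linarith
  have key : (c + k) * (((k + 1 : ℕ) : ℂ) * gammaRatioTerm a c (k + 1) x) =
      x * ((a + k) * gammaRatioTerm a c k x) := by
    rw [succ_mul_gammaRatioTerm_succ, gammaRatioTerm_eq_mul_add_one a c]
    simp only [gammaRatioTerm]
    rw [show a + 1 + (k : ℂ) = a + k + 1 by ring, Complex.Gamma_add_one _ ha2]
    ring
  have key' := congrArg norm key
  simp only [norm_mul, Complex.norm_natCast, Complex.norm_real, Real.norm_eq_abs] at key'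
  push_cast at key'
  set T := ‖gammaRatioTerm a c (k + 1) x‖
  set U := ‖gammaRatioTerm a c k x‖
  have hT : 0 ≤ T := norm_nonneg _
  have hU : 0 ≤ U := norm_nonneg _
  have hk0 : (0 : ℝ) < k := by linarith
  have h1 : (k : ℝ) / 2 * ((k + 1) * T) ≤ |x| * (2 * k * U) := by
    calc (k : ℝ) / 2 * ((k + 1) * T) ≤ ‖c + k‖ * ((k + 1) * T) := by gcongr
      _ = |x| * (‖a + k‖ * U) := key'
      _ ≤ _ := by gcongr
  have h2 : (k + 1) * T ≤ 4 * |x| * U := by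
    have : (k / 2 : ℝ) * ((k + 1) * T) ≤ k / 2 * (4 * |x| * U) := by linarith
    exact le_of_mul_le_mul_left this (by positivity)
  have h3 : (k + 1) * T ≤ (k + 1) * (1 / 2 * U) := by
    nlinarith
  exact le_of_mul_le_mul_left h3 (by positivity)

theorem gammaRatioSeries_eq_contiguous (a c : ℂ) (x : ℝ) :
    gammaRatioSeries a c x =
      c * gammaRatioSeries a (c + 1) x + x * gammaRatioSeries (a + 1) (c + 2) x := by
  have h1 : HasSum (fun k => c * gammaRatioTerm a (c + 1) k x)
      (c * gammaRatioSeries a (c + 1) x) :=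
    (summable_gammaRatioTerm a (c + 1) x).hasSum.mul_left c
  have h2 : HasSum (fun k : ℕ => (k : ℂ) * gammaRatioTerm a (c + 1) k x)
      (x * gammaRatioSeries (a + 1) (c + 2) x) := by
    rw [← hasSum_nat_add_iff' 1]
    simp only [succ_mul_gammaRatioTerm_succ, Finset.range_one, Finset.sum_singleton,
      Nat.cast_zero, zero_mul, sub_zero]
    rw [show c + 1 + 1 = c + 2 by ring]
    exact (summable_gammaRatioTerm (a + 1) (c + 2) x).hasSum.mul_left (x : ℂ)
  have h3 := h1.add h2
  simp only [← add_mul, ← gammaRatioTerm_eq_mul_add_one] at h3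
  exact h3.tsum_eq

theorem hasDerivAt_gammaRatioSeries (a c : ℂ) (x : ℝ) :
    HasDerivAt (gammaRatioSeries a c) (gammaRatioSeries (a + 1) (c + 1) x) x := by
  set R : ℝ := |x| + 1
  have hR : 0 < R := by positivity
  let g' : ℕ → ℝ → ℂ := fun k y =>
    Complex.Gamma (a + k) * (Complex.Gamma (c + k))⁻¹ *
      ((k * (y : ℂ) ^ (k - 1)) / (Nat.factorial k))
  have hg' : ∀ k y, g' (k + 1) y = gammaRatioTerm (a + 1) (c + 1) k y := by
    intro k y
    have hk : ((k : ℂ) + 1) ≠ 0 := Nat.cast_add_one_ne_zero k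
    have hf : ((Nat.factorial k : ℕ) : ℂ) ≠ 0 := by exact_mod_cast Nat.factorial_ne_zero k
    have ha : a + ((k + 1 : ℕ) : ℂ) = a + 1 + k := by push_cast; ring
    have hc : c + ((k + 1 : ℕ) : ℂ) = c + 1 + k := by push_cast; ring
    simp only [gammaRatioTerm, g']
    rw [ha, hc, Nat.factorial_succ, Nat.add_sub_cancel]
    push_cast
    field_simp
  have hg0 : ∀ y, g' 0 y = 0 := by simp [g']
  have hsum : ∀ y, HasSum (fun k => g' k y) (gammaRatioSeries (a + 1) (c + 1) y) := by
    intro y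
    rw [← hasSum_nat_add_iff' 1]
    simp only [hg', Finset.range_one, Finset.sum_singleton, hg0, sub_zero]
    exact (summable_gammaRatioTerm _ _ y).hasSum
  have hx : x ∈ Metric.ball (0 : ℝ) R := by simp [R]
  have := hasDerivAt_tsum_of_isPreconnected (u := fun k => ‖g' k R‖)
    (g := gammaRatioTerm a c) (g' := g') (t := Metric.ball (0 : ℝ) R) (y₀ := x) (y := x)
    (hsum R).summable.norm Metric.isOpen_ball (convex_ball _ _).isPreconnected ?_ ?_ hx
    (summable_gammaRatioTerm a c x) hx
  · rw [(hsum x).tsum_eq] at this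
    exact this
  · intro k y _
    have h1 : HasDerivAt (fun y : ℝ => (y : ℂ) ^ k) (k * (y : ℂ) ^ (k - 1)) y := by
      exact (hasDerivAt_pow k (y : ℂ)).comp_ofReal
    exact (h1.div_const _).const_mul _
  · intro k y hy
    have hy' : |y| ≤ R := by simpa using (Metric.mem_ball.mp hy).le
    simp only [g', norm_mul, norm_div, norm_pow, Complex.norm_real, Real.norm_eq_abs,
      abs_of_pos hR]
    gcongr

theorem norm_exp_mul_cpow {x : ℝ} (hx : 0 < x) (s : ℂ) :
    ‖Complex.exp x * (x : ℂ) ^ s‖ = Real.exp x * x ^ s.re := by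
  rw [norm_mul, Complex.norm_exp_ofReal, Complex.norm_cpow_eq_rpow_re_of_pos hx]

/-- `∑ Γ(a+k)/Γ(c+k) · x^k/k! = e^x x^{a-c} (1 + O(1/x))` as `x → ∞`. -/
def HasKummerAsymptotics (a c : ℂ) : Prop :=
  (fun x : ℝ => gammaRatioSeries a c x - Complex.exp x * (x : ℂ) ^ (a - c)) =O[Filter.atTop]
    fun x : ℝ => Real.exp x * x ^ ((a - c).re - 1)

theorem HasKummerAsymptotics.of_contiguous {a c : ℂ} (h1 : HasKummerAsymptotics a (c + 1))
    (h2 : HasKummerAsymptotics (a + 1) (c + 2)) : HasKummerAsymptotics a c := by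
  unfold HasKummerAsymptotics at *
  have e1 : (a - (c + 1)) = a - c - 1 := by ring
  have e2 : (a + 1 - (c + 2)) = a - c - 1 := by ring
  rw [e1] at h1
  rw [e2] at h2
  simp only [Complex.sub_re, Complex.one_re] at h1 h2 ⊢
  set r := a.re - c.re with hr
  have h1' : (fun x : ℝ => gammaRatioSeries a (c + 1) x - Complex.exp x * (x : ℂ) ^ (a - c - 1))
      =O[Filter.atTop] fun x : ℝ => Real.exp x * x ^ (r - 1) := by
    refine h1.trans (Asymptotics.IsBigO.of_bound 1 ?_)
    filter_upwards [Filter.eventually_ge_atTop 1] with x hx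
    have hx0 : 0 < x := by linarith
    rw [Real.norm_of_nonneg (by positivity), Real.norm_of_nonneg (by positivity), one_mul]
    gcongr
    · linarith
  have h3 : (fun x : ℝ => Complex.exp x * (x : ℂ) ^ (a - c - 1))
      =O[Filter.atTop] fun x : ℝ => Real.exp x * x ^ (r - 1) := by
    refine Asymptotics.IsBigO.of_bound 1 ?_
    filter_upwards [Filter.eventually_ge_atTop 1] with x hx
    have hx0 : 0 < x := by linarith
    rw [norm_exp_mul_cpow hx0, Real.norm_of_nonneg (by positivity), one_mul]
    simp [hr]
  have h4 : (fun x : ℝ => (x : ℂ) * (gammaRatioSeries (a + 1) (c + 2) x -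
      Complex.exp x * (x : ℂ) ^ (a - c - 1)))
      =O[Filter.atTop] fun x : ℝ => Real.exp x * x ^ (r - 1) := by
    have hid : (fun x : ℝ => (x : ℂ)) =O[Filter.atTop] fun x : ℝ => x :=
      Asymptotics.IsBigO.of_bound 1 (by simp)
    refine (hid.mul h2).congr' Filter.EventuallyEq.rfl ?_
    filter_upwards [Filter.eventually_gt_atTop 0] with x hx
    rw [Real.rpow_sub_one hx.ne' (r - 1)]
    field_simp
  refine (((h1'.const_mul_left c).add (h3.const_mul_left c)).add h4).congr' ?_
    Filter.EventuallyEq.rfl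
  filter_upwards [Filter.eventually_gt_atTop 0] with x hx
  have hx' : (x : ℂ) ≠ 0 := by exact_mod_cast hx.ne'
  rw [gammaRatioSeries_eq_contiguous a c x, Complex.cpow_sub _ _ hx', Complex.cpow_one]
  field_simp
  ring

theorem HasKummerAsymptotics.of_add_one {a c : ℂ} (h : HasKummerAsymptotics (a + 1) (c + 1)) :
    HasKummerAsymptotics a c := by
  unfold HasKummerAsymptotics at *
  rw [add_sub_add_right_eq_sub] at h
  set δ := a - c with hδ
  set r := δ.re with hr
  obtain ⟨K, hK, hb⟩ := h.exists_pos
  obtain ⟨x₀, hx₀⟩ := Filter.eventually_atTop.mp hb.bound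
  set x₁ := max (max x₀ 1) (2 * |r - 1|)
  have h10 : x₀ ≤ x₁ := (le_max_left _ _).trans (le_max_left _ _)
  have h11 : 1 ≤ x₁ := (le_max_right x₀ 1).trans (le_max_left _ _)
  have h12 : 2 * |r - 1| ≤ x₁ := le_max_right _ _
  have hpos : ∀ x, x₁ ≤ x → 0 < x := fun x hx => by linarith
  set G : ℝ → ℂ := fun x => gammaRatioSeries a c x - Complex.exp x * (x : ℂ) ^ δ
  set E : ℝ → ℝ := fun x => Real.exp x * x ^ (r - 1) with hE
  have hEpos : ∀ x, x₁ ≤ x → 0 < E x := fun x hx => by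
    have := hpos x hx
    positivity
  set K' := max (2 * (K + ‖δ‖)) (‖G x₁‖ / E x₁)
  have hK' : 2 * (K + ‖δ‖) ≤ K' := le_max_left _ _
  have hK'0 : 0 ≤ K' := le_trans (by positivity) hK'
  have hG : ∀ x, x₁ ≤ x → HasDerivAt G (gammaRatioSeries (a + 1) (c + 1) x -
      (Complex.exp x * (x : ℂ) ^ δ + Complex.exp x * (δ * (x : ℂ) ^ (δ - 1)))) x := by
    intro x hx
    have hx0 := hpos x hx
    have hexp : HasDerivAt (fun y : ℝ => Complex.exp y) (Complex.exp x) x :=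
      (Complex.hasDerivAt_exp x).comp_ofReal
    have hpow : HasDerivAt (fun y : ℝ => (y : ℂ) ^ δ) (δ * (x : ℂ) ^ (δ - 1)) x := by
      simpa using ((hasDerivAt_id (x : ℂ)).cpow_const (c := δ)
        (Complex.ofReal_mem_slitPlane.mpr hx0)).comp_ofReal
    exact (hasDerivAt_gammaRatioSeries a c x).sub (hexp.mul hpow)
  have hE' : ∀ x, x₁ ≤ x → HasDerivAt E
      (Real.exp x * x ^ (r - 1) + Real.exp x * ((r - 1) * x ^ (r - 1 - 1))) x := by
    intro x hx
    exact (Real.hasDerivAt_exp x).mul (Real.hasDerivAt_rpow_const (Or.inl (hpos x hx).ne'))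
  have hmain : ∀ x, x₁ ≤ x → ‖G x‖ ≤ K' * E x := by
    intro x hx
    refine image_norm_le_of_norm_deriv_right_le_deriv_boundary' (a := x₁) (b := x) (f := G)
      (B := fun x => K' * E x)
      (fun y hy => (hG y hy.1).continuousAt.continuousWithinAt)
      (fun y hy => (hG y hy.1).hasDerivWithinAt) ?_
      (fun y hy => ((hE' y hy.1).const_mul K').continuousAt.continuousWithinAt)
      (fun y hy => ((hE' y hy.1).const_mul K').hasDerivWithinAt) ?_ ⟨hx, le_rfl⟩
    · rw [← div_le_iff₀ (hEpos x₁ le_rfl)]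
      exact le_max_right _ _
    · intro y hy
      have hy0 := hpos y hy.1
      have hEy := hEpos y hy.1
      have b1 : ‖gammaRatioSeries (a + 1) (c + 1) y - Complex.exp y * (y : ℂ) ^ δ‖ ≤ K * E y := by
        have := hx₀ y (h10.trans hy.1)
        rwa [Real.norm_of_nonneg hEy.le] at this
      have b2 : ‖δ * (Complex.exp y * (y : ℂ) ^ (δ - 1))‖ = ‖δ‖ * E y := by
        rw [norm_mul, norm_exp_mul_cpow hy0]
        simp [hE, hr]
      have b3 : (K + ‖δ‖) * E y ≤
          K' * (Real.exp y * y ^ (r - 1) + Real.exp y * ((r - 1) * y ^ (r - 1 - 1))) := by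
        have e : Real.exp y * y ^ (r - 1) + Real.exp y * ((r - 1) * y ^ (r - 1 - 1)) =
            E y * (1 + (r - 1) / y) := by
          rw [Real.rpow_sub_one hy0.ne' (r - 1)]
          simp only [hE]
          field_simp
        have hq : -(1 / 2) ≤ (r - 1) / y := by
          rw [le_div_iff₀ hy0]
          have := neg_abs_le (r - 1)
          have := hy.1
          linarith
        rw [e]
        calc (K + ‖δ‖) * E y ≤ K' / 2 * E y := by gcongr; linarith
          _ = K' * (E y * (1 / 2)) := by ring
          _ ≤ _ := by gcongr; linarith
      calc _ = ‖(gammaRatioSeries (a + 1) (c + 1) y - Complex.exp y * (y : ℂ) ^ δ) -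
            δ * (Complex.exp y * (y : ℂ) ^ (δ - 1))‖ := by congr 1; ring
        _ ≤ K * E y + ‖δ‖ * E y := (norm_sub_le _ _).trans (by rw [b2]; gcongr)
        _ = (K + ‖δ‖) * E y := by ring
        _ ≤ _ := b3
  refine Asymptotics.IsBigO.of_bound K' ?_
  filter_upwards [Filter.eventually_ge_atTop x₁] with x hx
  rw [Real.norm_of_nonneg (hEpos x hx).le]
  exact hmain x hx

theorem norm_one_sub_cpow_sub_one_le {a : ℂ} (ha : 2 ≤ a.re) {u : ℝ} (hu0 : 0 ≤ u)
    (hu1 : u < 1) : ‖(1 - (u : ℂ)) ^ (a - 1) - 1‖ ≤ ‖a - 1‖ * u := by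
  have hd : ∀ y ∈ Set.Ico (0 : ℝ) 1, HasDerivWithinAt (fun y : ℝ => (1 - (y : ℂ)) ^ (a - 1))
      ((a - 1) * (1 - (y : ℂ)) ^ (a - 1 - 1) * (-1)) (Set.Ico (0 : ℝ) 1) y := by
    intro y hy
    have hs : (1 - (y : ℂ)) ∈ Complex.slitPlane := by
      rw [← Complex.ofReal_one, ← Complex.ofReal_sub]
      exact Complex.ofReal_mem_slitPlane.mpr (sub_pos.mpr hy.2)
    exact ((((hasDerivAt_id (y : ℂ)).const_sub 1).cpow_const hs).comp_ofReal).hasDerivWithinAt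
  have hb : ∀ y ∈ Set.Ico (0 : ℝ) 1,
      ‖(a - 1) * (1 - (y : ℂ)) ^ (a - 1 - 1) * (-1)‖ ≤ ‖a - 1‖ := by
    intro y hy
    have hp : 0 < 1 - y := sub_pos.mpr hy.2
    rw [norm_mul, norm_mul, norm_neg, norm_one, mul_one, ← Complex.ofReal_one,
      ← Complex.ofReal_sub, Complex.norm_cpow_eq_rpow_re_of_pos hp]
    refine mul_le_of_le_one_right (norm_nonneg _) (Real.rpow_le_one hp.le ?_ ?_)
    · linarith [hy.1]
    · simp only [Complex.sub_re, Complex.ofReal_re]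
      linarith
  have := Convex.norm_image_sub_le_of_norm_hasDerivWithin_le hd hb (convex_Ico 0 1)
    (Set.left_mem_Ico.mpr one_pos) ⟨hu0, hu1⟩
  simpa [abs_of_nonneg hu0] using this

theorem Gamma_mul_gammaRatioSeries_eq_integral {a c : ℂ} (ha : 0 < a.re) (hs : 0 < (c - a).re)
    (x : ℝ) :
    Complex.Gamma (c - a) * gammaRatioSeries a c x =
      ∫ u in (0 : ℝ)..1, (u : ℂ) ^ (c - a - 1) * (1 - (u : ℂ)) ^ (a - 1) *
        Complex.exp (x * (1 - u)) := by
  set w : ℝ → ℂ := fun u => (u : ℂ) ^ (c - a - 1) * (1 - (u : ℂ)) ^ (a - 1) with hw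
  have hwi : IntervalIntegrable w MeasureTheory.volume 0 1 :=
    Complex.betaIntegral_convergent hs ha
  have hwm : MeasureTheory.AEStronglyMeasurable w
      (MeasureTheory.volume.restrict (Set.uIoc 0 1)) := by
    rw [Set.uIoc_of_le zero_le_one]
    exact hwi.1.aestronglyMeasurable
  have hmem : ∀ {t : ℝ}, t ∈ Set.uIoc (0 : ℝ) 1 → 0 < t ∧ t ≤ 1 := fun ht => by
    rwa [Set.uIoc_of_le zero_le_one] at ht
  have hsum : HasSum (fun k : ℕ => ∫ u in (0 : ℝ)..1,
      w u * ((x * (1 - u) : ℂ) ^ k / (Nat.factorial k)))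
      (∫ u in (0 : ℝ)..1, w u * Complex.exp (x * (1 - u))) := by
    refine intervalIntegral.hasSum_integral_of_dominated_convergence
      (fun k t => ‖w t‖ * (|x| ^ k / (Nat.factorial k))) ?_ ?_ ?_ ?_ ?_
    · intro k
      refine hwm.mul (Continuous.aestronglyMeasurable ?_)
      fun_prop
    · intro k
      refine Filter.Eventually.of_forall fun t ht => ?_
      obtain ⟨h0, h1⟩ := hmem ht
      have : ‖(x * (1 - t) : ℂ)‖ ≤ |x| := by
        rw [← Complex.ofReal_one, ← Complex.ofReal_sub, ← Complex.ofReal_mul, Complex.norm_real,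
          Real.norm_eq_abs, abs_mul]
        refine mul_le_of_le_one_right (abs_nonneg _) ?_
        rw [abs_le]
        constructor <;> linarith
      rw [norm_mul, norm_div, norm_pow, Complex.norm_natCast]
      gcongr
    · exact Filter.Eventually.of_forall fun t _ =>
        (Real.summable_pow_div_factorial |x|).mul_left _
    · simp only [tsum_mul_left]
      exact hwi.norm.mul_const _
    · refine Filter.Eventually.of_forall fun t _ => ?_
      rw [Complex.exp_eq_exp_ℂ]
      exact (NormedSpace.expSeries_div_hasSum_exp (x * (1 - t) : ℂ)).mul_left _
  rw [← hsum.tsum_eq, gammaRatioSeries, ← tsum_mul_left]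
  refine tsum_congr fun k => ?_
  have hak : 0 < (a + k).re := by
    rw [Complex.add_re, Complex.natCast_re]
    positivity
  have hck : c + k = c - a + (a + k) := by ring
  have hne : Complex.Gamma (c + k) ≠ 0 := by
    apply Complex.Gamma_ne_zero_of_re_pos
    rw [hck, Complex.add_re]
    positivity
  have hbeta := Complex.Gamma_mul_Gamma_eq_betaIntegral hs hak
  rw [← hck] at hbeta
  have hint : ∫ u in (0 : ℝ)..1, w u * ((x * (1 - u) : ℂ) ^ k / (Nat.factorial k)) =
      ((x : ℂ) ^ k / (Nat.factorial k)) * (c - a).betaIntegral (a + k) := by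
    rw [Complex.betaIntegral, ← intervalIntegral.integral_const_mul]
    refine intervalIntegral.integral_congr_Ioo_of_le zero_le_one ?_
    intro u hu
    have hu' : (1 - (u : ℂ)) ≠ 0 := by
      exact_mod_cast (sub_pos.mpr hu.2).ne'
    simp only [hw]
    rw [show a + k - 1 = a - 1 + k by ring, Complex.cpow_add _ _ hu', Complex.cpow_natCast,
      mul_pow]
    ring
  rw [hint, gammaRatioTerm]
  calc _ = Complex.Gamma (c - a) * Complex.Gamma (a + k) * (Complex.Gamma (c + k))⁻¹ *
        ((x : ℂ) ^ k / (Nat.factorial k)) := by ring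
    _ = _ := by
      rw [hbeta]
      field_simp

theorem HasKummerAsymptotics.of_two_le_re {a c : ℂ} (ha : 2 ≤ a.re) (hs : 0 < (c - a).re) :
    HasKummerAsymptotics a c := by
  set s := c - a with hsdef
  set σ := s.re with hσ
  have hΓ : Complex.Gamma s ≠ 0 := Complex.Gamma_ne_zero_of_re_pos hs
  set C := ‖a - 1‖ + 1 with hC
  have hCpos : 0 < C := by positivity
  set g : ℝ → ℂ := fun u => (Set.Iio (1 : ℝ)).indicator (fun u : ℝ => (1 - (u : ℂ)) ^ (a - 1)) u - 1
    with hg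
  have hgb : ∀ u : ℝ, 0 < u → ‖g u‖ ≤ C * u := by
    intro u hu
    by_cases h1 : u < 1
    · simp only [hg, Set.indicator_of_mem (Set.mem_Iio.mpr h1)]
      refine (norm_one_sub_cpow_sub_one_le ha hu.le h1).trans ?_
      gcongr
      simp [hC]
    · simp only [hg, Set.indicator_of_notMem (show u ∉ Set.Iio (1 : ℝ) from h1), zero_sub,
        norm_neg, norm_one]
      have : 0 ≤ ‖a - 1‖ := norm_nonneg _
      nlinarith [not_lt.mp h1]
  have hmain : ∀ x : ℝ, 0 < x → Complex.Gamma s * (gammaRatioSeries a c x -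
      Complex.exp x * (x : ℂ) ^ (a - c)) = Complex.exp x *
        ∫ u in Set.Ioi (0 : ℝ), (u : ℂ) ^ (s - 1) * Complex.exp (-(x * u)) * g u := by
    intro x hx
    have hx' : (x : ℂ) ≠ 0 := by exact_mod_cast hx.ne'
    have hG := Complex.integral_cpow_mul_exp_neg_mul_Ioi hs hx
    have hpow : (1 / (x : ℂ)) ^ s = (x : ℂ) ^ (a - c) := by
      rw [one_div, Complex.inv_cpow _ _ (by
        rw [Complex.arg_ofReal_of_nonneg hx.le]; exact Real.pi_pos.ne), ← Complex.cpow_neg]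
      congr 1
      rw [hsdef]
      ring
    have hGi : MeasureTheory.IntegrableOn
        (fun u : ℝ => (u : ℂ) ^ (s - 1) * Complex.exp (-(x * u))) (Set.Ioi 0) := by
      by_contra hni
      rw [MeasureTheory.integral_undef hni] at hG
      refine mul_ne_zero ?_ hΓ hG.symm
      simp [Complex.cpow_eq_zero_iff, hx']
    have hFi : MeasureTheory.IntegrableOn (fun u : ℝ => (u : ℂ) ^ (s - 1) *
        (1 - (u : ℂ)) ^ (a - 1) * Complex.exp (-(x * u))) (Set.Ioo 0 1) := by
      have h0 := Complex.betaIntegral_convergent hs (show 0 < a.re by linarith)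
      have h1 := h0.mul_continuousOn (g := fun u : ℝ => Complex.exp (-(x * u)))
        (by fun_prop)
      exact h1.1.mono_set Set.Ioo_subset_Ioc_self
    have hFi' : MeasureTheory.IntegrableOn ((Set.Iio (1 : ℝ)).indicator fun u : ℝ =>
        (u : ℂ) ^ (s - 1) * (1 - (u : ℂ)) ^ (a - 1) * Complex.exp (-(x * u))) (Set.Ioi 0) := by
      rw [MeasureTheory.IntegrableOn, MeasureTheory.integrable_indicator_iff measurableSet_Iio,
        MeasureTheory.IntegrableOn, MeasureTheory.Measure.restrict_restrict measurableSet_Iio,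
        Set.Iio_inter_Ioi]
      exact hFi
    have hsplit : ∫ u in Set.Ioi (0 : ℝ), (u : ℂ) ^ (s - 1) * Complex.exp (-(x * u)) * g u =
        (∫ u in Set.Ioo (0 : ℝ) 1, (u : ℂ) ^ (s - 1) * (1 - (u : ℂ)) ^ (a - 1) *
          Complex.exp (-(x * u))) -
        ∫ u in Set.Ioi (0 : ℝ), (u : ℂ) ^ (s - 1) * Complex.exp (-(x * u)) := by
      rw [← Set.Ioi_inter_Iio, ← MeasureTheory.setIntegral_indicator measurableSet_Iio,
        ← MeasureTheory.integral_sub hFi' hGi]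
      congr 1
      funext u
      by_cases h1 : u < 1
      · simp only [hg, Set.indicator_of_mem (Set.mem_Iio.mpr h1)]
        ring
      · simp only [hg, Set.indicator_of_notMem (show u ∉ Set.Iio (1 : ℝ) from h1)]
        ring
    rw [hsplit, hG, hpow, mul_sub, Gamma_mul_gammaRatioSeries_eq_integral (by linarith) hs,
      intervalIntegral.integral_of_le zero_le_one, MeasureTheory.integral_Ioc_eq_integral_Ioo,
      mul_sub, ← MeasureTheory.integral_const_mul]
    congr 1
    · congr 1
      funext u
      rw [show (x * (1 - u) : ℂ) = x + -(x * u) by ring, Complex.exp_add]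
      ring
    · ring
  refine Asymptotics.IsBigO.of_bound (C * Real.Gamma (σ + 1) / ‖Complex.Gamma s‖) ?_
  filter_upwards [Filter.eventually_gt_atTop 0] with x hx
  have hint : ‖∫ u in Set.Ioi (0 : ℝ), (u : ℂ) ^ (s - 1) * Complex.exp (-(x * u)) * g u‖ ≤
      C * ((1 / x) ^ (σ + 1) * Real.Gamma (σ + 1)) := by
    rw [← Real.integral_rpow_mul_exp_neg_mul_Ioi (by positivity) hx,
      ← MeasureTheory.integral_const_mul]
    refine MeasureTheory.norm_integral_le_of_norm_le ?_ ?_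
    · have := integrableOn_rpow_mul_exp_neg_mul_rpow (show -1 < σ by linarith) one_pos hx
      simpa using this.const_mul C
    · refine (MeasureTheory.ae_restrict_iff' measurableSet_Ioi).mpr
        (Filter.Eventually.of_forall fun u hu => ?_)
      have hu : 0 < u := hu
      rw [norm_mul, norm_mul, Complex.norm_cpow_eq_rpow_re_of_pos hu, ← Complex.ofReal_mul,
        ← Complex.ofReal_neg, Complex.norm_exp_ofReal, Complex.sub_re, Complex.one_re, ← hσ]
      calc _ ≤ u ^ (σ - 1) * Real.exp (-(x * u)) * (C * u) := by
            gcongr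
            exact hgb u hu
        _ = _ := by
            rw [add_sub_cancel_right, Real.rpow_sub_one hu.ne']
            field_simp
  have hkey := congrArg norm (hmain x hx)
  rw [norm_mul, norm_mul, Complex.norm_exp_ofReal] at hkey
  have hre : (a - c).re - 1 = -(σ + 1) := by
    simp only [hσ, hsdef, Complex.sub_re]
    ring
  rw [hre, Real.rpow_neg hx.le, Real.norm_of_nonneg (by positivity), div_mul_eq_mul_div,
    le_div_iff₀ (norm_pos_iff.mpr hΓ), mul_comm, hkey]
  calc _ ≤ Real.exp x * (C * ((1 / x) ^ (σ + 1) * Real.Gamma (σ + 1))) := by gcongr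
    _ = _ := by
      rw [one_div, Real.inv_rpow hx.le]
      ring

theorem HasKummerAsymptotics.of_re_lt {a c : ℂ} (hs : 0 < (c - a).re) :
    HasKummerAsymptotics a c := by
  obtain ⟨n, hn⟩ := exists_nat_ge (2 - a.re)
  induction n generalizing a c with
  | zero => exact .of_two_le_re (by simpa using hn) hs
  | succ n ih =>
    refine .of_add_one (ih (by simpa using hs) ?_)
    rw [Complex.add_re, Complex.one_re]
    push_cast at hn
    linarith

theorem hasKummerAsymptotics (a c : ℂ) : HasKummerAsymptotics a c := by
  obtain ⟨n, hn⟩ := exists_nat_gt (-(c - a).re)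
  induction n generalizing a c with
  | zero => exact .of_re_lt (by simpa using hn)
  | succ n ih =>
    simp only [Complex.sub_re] at hn
    push_cast at hn
    refine .of_contiguous (ih _ _ ?_) (ih _ _ ?_)
    · simp only [Complex.sub_re, Complex.add_re, Complex.one_re]
      linarith
    · simp only [Complex.sub_re, Complex.add_re, Complex.one_re, Complex.re_ofNat]
      linarith

theorem Gamma_mul_poch {a : ℂ} (h : ∀ j : ℕ, a ≠ -(j : ℂ)) (k : ℕ) :
    Complex.Gamma a * poch a k = Complex.Gamma (a + k) := by
  induction k with
  | zero => simp [poch]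
  | succ k ih =>
    have hk : a + k ≠ 0 := fun h0 => h k (eq_neg_of_add_eq_zero_left h0)
    rw [poch, Finset.prod_range_succ, ← poch, ← mul_assoc, ih, mul_comm,
      ← Complex.Gamma_add_one _ hk]
    push_cast
    rw [add_assoc]

theorem Gamma_mul_regF1 {a : ℂ} (h : ∀ j : ℕ, a ≠ -(j : ℂ)) (c : ℂ) (x : ℝ) :
    Complex.Gamma a * regF1 a c x = gammaRatioSeries a c x := by
  rw [regF1, gammaRatioSeries, ← tsum_mul_left]
  refine tsum_congr fun k => ?_
  rw [gammaRatioTerm, ← Gamma_mul_poch h k]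
  simp only [div_eq_mul_inv, mul_inv]
  ring

/-- If `1/2+m−β` is not a nonpositive integer, then
`ℐ_{β,m}(x) = x^{−β} e^{x/2} (1+O(1/x))/Γ(1/2+m−β)` as `x → ∞`:
there are `C > 0` and `x₀ > 0` such that for all `x ≥ x₀`,
`|Γ(1/2+m−β) x^{β} e^{−x/2} ℐ_{β,m}(x) − 1| ≤ C/x`. -/
theorem WI_asymptotics_at_infinity (β m : ℂ)
    (h : ∀ j : ℕ, (1 : ℂ) / 2 + m - β ≠ -(j : ℂ)) :
    ∃ C : ℝ, 0 < C ∧ ∃ x₀ : ℝ, 0 < x₀ ∧ ∀ x : ℝ, x₀ ≤ x →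
      ‖Complex.Gamma (1 / 2 + m - β) * (x : ℂ) ^ β * Complex.exp (-(x : ℂ) / 2) *
        WI β m (x : ℂ) - 1‖ ≤ C / x := by
  set a := (1 : ℂ) / 2 + m - β with ha
  set c := 1 + 2 * m with hc
  obtain ⟨C, hC, hb⟩ := (hasKummerAsymptotics a c).exists_pos
  obtain ⟨x₀, hx₀⟩ := Filter.eventually_atTop.mp hb.bound
  refine ⟨C, hC, max x₀ 1, by positivity, fun x hx => ?_⟩
  have hx1 : 0 < x := lt_of_lt_of_le one_pos ((le_max_right _ _).trans hx)
  have hx' : (x : ℂ) ≠ 0 := by exact_mod_cast hx1.ne'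
  have hbx := hx₀ x ((le_max_left _ _).trans hx)
  rw [Real.norm_of_nonneg (by positivity)] at hbx
  have hexp : Complex.exp (-(x : ℂ) / 2) * Complex.exp (-(x : ℂ) / 2) = Complex.exp (-x) := by
    rw [← Complex.exp_add]
    congr 1
    ring
  have hpow : (x : ℂ) ^ β * (x : ℂ) ^ ((1 : ℂ) / 2 + m) = (x : ℂ) ^ (c - a) := by
    rw [← Complex.cpow_add _ _ hx']
    congr 1
    rw [ha, hc]
    ring
  have hone : Complex.exp (-x) * (x : ℂ) ^ (c - a) * (Complex.exp x * (x : ℂ) ^ (a - c)) = 1 := by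
    calc _ = Complex.exp (-x) * Complex.exp x * ((x : ℂ) ^ (c - a) * (x : ℂ) ^ (a - c)) := by ring
      _ = 1 := by
        rw [← Complex.exp_add, ← Complex.cpow_add _ _ hx']
        simp
  have hmain : Complex.Gamma a * (x : ℂ) ^ β * Complex.exp (-(x : ℂ) / 2) * WI β m x - 1 =
      Complex.exp (-x) * (x : ℂ) ^ (c - a) *
        (gammaRatioSeries a c x - Complex.exp x * (x : ℂ) ^ (a - c)) := by
    rw [mul_sub, hone, ← Gamma_mul_regF1 h, ← hexp, ← hpow, WI]
    ring
  rw [hmain, norm_mul, ← Complex.ofReal_neg, norm_mul, Complex.norm_exp_ofReal,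
    Complex.norm_cpow_eq_rpow_re_of_pos hx1]
  calc _ ≤ Real.exp (-x) * x ^ (c - a).re * (C * (Real.exp x * x ^ ((a - c).re - 1))) := by gcongr
    _ = C * ((Real.exp (-x) * Real.exp x) * (x ^ (c - a).re * x ^ ((a - c).re - 1))) := by ring
    _ = C / x := by
      rw [← Real.exp_add, ← Real.rpow_add hx1, neg_add_cancel, Real.exp_zero, one_mul,
        show (c - a).re + ((a - c).re - 1) = -1 by simp only [Complex.sub_re]; ring,
        Real.rpow_neg_one, div_eq_mul_inv]
end
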